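/- Let H be a Hamiltonian on [a,b) such that neither h1 nor h2 vanishes a.e. on any neighbourhood of a, let g be a regularly varying function with index α ≤ 2 and lim_{r→∞} g(r) = ∞, and let μ_H be the spectral measure of H. Then: (i) if limsup_{t→a} m1(t)/[(m1·m2)(t)·g((m1·m2)(t)^{−1/2})] < ∞, then μ_H ∈ F_g; (ii) if lim_{t→a} m1(t)/[(m1·m2)(t)·g((m1·m2)(t)^{−1/2})] = 0, then μ_H ∈ F_g⁰. If in addition α < 2, then: (iii) μ_H ∈ F_g implies limsup_{t→a} (det M(t)/m2(t))/[(m1·m2)(t)·g((m1·m2)(t)^{−1/2})] < ∞; (iv) μ_H ∈ F_g⁰ implies lim_{t→a} (det M(t)/m2(t))/[(m1·m2)(t)·g((m1·m2)(t)^{−1/2})] = 0. -/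

import Mathlib

open MeasureTheory Filter Topology Matrix Set
open scoped ENNReal

noncomputable section

/-- The symplectic matrix `J = [[0,-1],[1,0]]` (real version). -/
def Jmat : Matrix (Fin 2) (Fin 2) ℝ := !![0, -1; 1, 0]

/-- The symplectic matrix `J` (complex version). -/
def JmatC : Matrix (Fin 2) (Fin 2) ℂ := !![0, -1; 1, 0]

/-- `|J| = [[0,1],[1,0]]`. -/
def Jabs : Matrix (Fin 2) (Fin 2) ℝ := !![0, 1; 1, 0]

/-- The entrywise comparison `|U| ⪯ V`. -/
def entryAbsLe (U V : Matrix (Fin 2) (Fin 2) ℝ) : Prop :=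
  ∀ i j, |U i j| ≤ V i j

/-- The filter describing `t → b⁻`, `t` ranging over the reals, `b : EReal`. -/
def toBFilter (b : EReal) : Filter ℝ :=
  Filter.comap (fun t : ℝ => (t : EReal)) (nhdsWithin b (Set.Iio b))

/-- `H` is a Hamiltonian on `[a, b)`. -/
structure IsHamiltonian (a : ℝ) (b : EReal) (H : ℝ → Matrix (Fin 2) (Fin 2) ℝ) : Prop where
  a_lt_b : (a : EReal) < b
  posSemidef : ∀ᵐ (t : ℝ) ∂volume, a ≤ t → (t : EReal) < b → (H t).PosSemidef
  locInt : ∀ (i j : Fin 2) (t : ℝ), a ≤ t → (t : EReal) < b →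
    IntervalIntegrable (fun s => H s i j) volume a t
  zero_null : volume {t : ℝ | a ≤ t ∧ (t : EReal) < b ∧ H t = 0} = 0
  limit_point : (∫⁻ t in {t : ℝ | a ≤ t ∧ (t : EReal) < b},
    ENNReal.ofReal ((H t).trace)) = ⊤

/-- `m1(t) = ∫_a^t h1`. -/
def m1 (a : ℝ) (H : ℝ → Matrix (Fin 2) (Fin 2) ℝ) (t : ℝ) : ℝ := ∫ s in a..t, H s 0 0

/-- `m2(t) = ∫_a^t h2`. -/
def m2 (a : ℝ) (H : ℝ → Matrix (Fin 2) (Fin 2) ℝ) (t : ℝ) : ℝ := ∫ s in a..t, H s 1 1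

/-- `m3(t) = ∫_a^t h3`. -/
def m3 (a : ℝ) (H : ℝ → Matrix (Fin 2) (Fin 2) ℝ) (t : ℝ) : ℝ := ∫ s in a..t, H s 0 1

/-- `M(t) = ∫_a^t H(s) ds`. -/
def Mmat (a : ℝ) (H : ℝ → Matrix (Fin 2) (Fin 2) ℝ) (t : ℝ) : Matrix (Fin 2) (Fin 2) ℝ :=
  !![m1 a H t, m3 a H t; m3 a H t, m2 a H t]

/-- Neither diagonal entry of `H` vanishes a.e. on any neighbourhood of `a`. -/
def DiagNonVanishing (a : ℝ) (b : EReal) (H : ℝ → Matrix (Fin 2) (Fin 2) ℝ) : Prop :=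
  (∀ t : ℝ, a < t → (t : EReal) < b →
    ¬ ∀ᵐ s ∂(volume.restrict (Set.Ioo a t)), H s 0 0 = 0) ∧
  (∀ t : ℝ, a < t → (t : EReal) < b →
    ¬ ∀ᵐ s ∂(volume.restrict (Set.Ioo a t)), H s 1 1 = 0)

/-- `W` is the fundamental solution of `W(t,z)J − J = z ∫_a^t W(s,z)H(s) ds`. -/
def IsFundamentalSolution (a : ℝ) (b : EReal) (H : ℝ → Matrix (Fin 2) (Fin 2) ℝ)
    (W : ℝ → ℂ → Matrix (Fin 2) (Fin 2) ℂ) : Prop :=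
  ∀ (z : ℂ) (t : ℝ), a ≤ t → (t : EReal) < b →
    W t z * JmatC - JmatC =
      z • Matrix.of fun i j =>
        ∫ s in a..t, (W s z * (H s).map (fun x : ℝ => (x : ℂ))) i j

/-- `qH` is the Weyl coefficient of the Hamiltonian `H`. -/
def IsWeylCoefficient (a : ℝ) (b : EReal) (H : ℝ → Matrix (Fin 2) (Fin 2) ℝ)
    (qH : ℂ → ℂ) : Prop :=
  ∃ W : ℝ → ℂ → Matrix (Fin 2) (Fin 2) ℂ,
    IsFundamentalSolution a b H W ∧
    ∀ z : ℂ, z.im ≠ 0 → ∀ ζ : ℂ, 0 ≤ ζ.im →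
      Tendsto (fun t : ℝ =>
          (W t z 0 0 * ζ + W t z 0 1) / (W t z 1 0 * ζ + W t z 1 1))
        (toBFilter b) (nhds (qH z))

/-- `μ` is the spectral measure of `H`, i.e. the measure in the Herglotz
representation of the Weyl coefficient of `H`. -/
def IsSpectralMeasure (a : ℝ) (b : EReal) (H : ℝ → Matrix (Fin 2) (Fin 2) ℝ)
    (μ : Measure ℝ) : Prop :=
  ∃ qH : ℂ → ℂ, IsWeylCoefficient a b H qH ∧
    (∫⁻ t : ℝ, ENNReal.ofReal (1 / (1 + t ^ 2)) ∂μ) < ⊤ ∧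
    ∃ α β : ℝ, 0 ≤ β ∧ ∀ z : ℂ, z.im ≠ 0 →
      qH z = (α : ℂ) + (β : ℂ) * z +
        ∫ t : ℝ, (1 / ((t : ℂ) - z) - (t : ℂ) / (1 + (t : ℂ) ^ 2)) ∂μ

/-- `μ↔(r) = μ((−r, r))`. -/
def muSym (μ : Measure ℝ) (r : ℝ) : ℝ≥0∞ := μ (Set.Ioo (-r) r)

/-- Poisson integral of a measure. -/
def poisson (μ : Measure ℝ) (z : ℂ) : ℝ := ∫ t : ℝ, (1 / ((t : ℂ) - z)).im ∂μ

/-- `g : (0,∞) → (0,∞)` is regularly varying with index `ρ`. -/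
def RegularlyVarying (g : ℝ → ℝ) (ρ : ℝ) : Prop :=
  Measurable g ∧ (∀ r : ℝ, 0 < r → 0 < g r) ∧
  ∀ l : ℝ, 0 < l → Tendsto (fun r : ℝ => g (l * r) / g r) atTop (nhds (l ^ ρ))

/-- `g⋆(r) = ∫_1^r t/g(t) dt`. -/
def gstar (g : ℝ → ℝ) (r : ℝ) : ℝ := ∫ t in (1:ℝ)..r, t / g t

/-- The Kac class `𝓜_g`. -/
def memMg (g : ℝ → ℝ) (μ : Measure ℝ) : Prop :=
  (∫⁻ r in Set.Ici (1:ℝ), ENNReal.ofReal (1 / g r)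
    ∂(Measure.map (fun t : ℝ => |t|) μ)) < ⊤

/-- The class `𝓜̂_g`. -/
def memMhat (g : ℝ → ℝ) (μ : Measure ℝ) : Prop :=
  (∫⁻ r in Set.Ioi (1:ℝ), muSym μ r * ENNReal.ofReal (gstar g r / r ^ 3)) < ⊤

/-- The class `𝓕_g`: `μ↔(r) = O(g(r))`. -/
def memFg (g : ℝ → ℝ) (μ : Measure ℝ) : Prop :=
  ∃ C : ℝ, ∀ᶠ r in atTop, muSym μ r ≤ ENNReal.ofReal (C * g r)

/-- The class `𝓕_g⁰`: `μ↔(r) = o(g(r))`. -/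
def memFg0 (g : ℝ → ℝ) (μ : Measure ℝ) : Prop :=
  ∀ ε : ℝ, 0 < ε → ∀ᶠ r in atTop, muSym μ r ≤ ENNReal.ofReal (ε * g r)

/-- `M⁺(t)`. -/
def MplusMat (a : ℝ) (H : ℝ → Matrix (Fin 2) (Fin 2) ℝ) (t : ℝ) :
    Matrix (Fin 2) (Fin 2) ℝ :=
  !![m1 a H t, Real.sqrt (m1 a H t * m2 a H t);
     Real.sqrt (m1 a H t * m2 a H t), m2 a H t]

/-- `m⁺(t) = 2√(m1(t)m2(t))`. -/
def mplus (a : ℝ) (H : ℝ → Matrix (Fin 2) (Fin 2) ℝ) (t : ℝ) : ℝ :=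
  2 * Real.sqrt (m1 a H t * m2 a H t)

/-- `W` is the sequence of power series coefficients of the fundamental solution:
`W_0 = I`, `W_{n+1}(t) = (∫_a^t W_n H)·(−J)`. -/
def IsCoeffSeq (a : ℝ) (H : ℝ → Matrix (Fin 2) (Fin 2) ℝ)
    (W : ℕ → ℝ → Matrix (Fin 2) (Fin 2) ℝ) : Prop :=
  (∀ t : ℝ, W 0 t = 1) ∧
  ∀ (n : ℕ) (t : ℝ),
    W (n + 1) t = (Matrix.of fun i j => ∫ s in a..t, (W n s * H s) i j) * (-Jmat)

/-- Entrywise integral of a matrix-valued function. -/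
def intMat (f : ℝ → Matrix (Fin 2) (Fin 2) ℝ) (a t : ℝ) : Matrix (Fin 2) (Fin 2) ℝ :=
  Matrix.of fun i j => ∫ s in a..t, f s i j

/-- `α_{n,m}(t) = ∫_a^t W_n H W_m* ds`. -/
def alphaMat (a : ℝ) (H : ℝ → Matrix (Fin 2) (Fin 2) ℝ)
    (W : ℕ → ℝ → Matrix (Fin 2) (Fin 2) ℝ) (n m : ℕ) (t : ℝ) :
    Matrix (Fin 2) (Fin 2) ℝ :=
  intMat (fun s => W n s * H s * (W m s)ᵀ) a t

/-- `β_{n,m}(t) = W_n(t) J W_m(t)*`. -/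
def betaMat (W : ℕ → ℝ → Matrix (Fin 2) (Fin 2) ℝ) (n m : ℕ) (t : ℝ) :
    Matrix (Fin 2) (Fin 2) ℝ :=
  W n t * Jmat * (W m t)ᵀ

/-- `∇(t,z) = ∫_a^t W(s,z) H(s) W(s,z)* ds`. -/
def nablaMat (a : ℝ) (H : ℝ → Matrix (Fin 2) (Fin 2) ℝ)
    (W : ℝ → ℂ → Matrix (Fin 2) (Fin 2) ℂ) (t : ℝ) (z : ℂ) :
    Matrix (Fin 2) (Fin 2) ℂ :=
  Matrix.of fun i j =>
    ∫ s in a..t, (W s z * (H s).map (fun x : ℝ => (x : ℂ)) * (W s z)ᴴ) i j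

/-- Generalised inverse of `f : [a,b) → ℝ`. -/
def genInv (a : ℝ) (b : EReal) (f : ℝ → ℝ) (y : ℝ) : ℝ :=
  sInf {x : ℝ | a ≤ x ∧ (x : EReal) < b ∧ y ≤ f x}

/-- Generalised inverse of `f : [0,b) → [0,∞]`. -/
def genInvE (b : EReal) (f : ℝ → ℝ≥0∞) (y : ℝ) : ℝ :=
  sInf {x : ℝ | 0 ≤ x ∧ (x : EReal) < b ∧ ENNReal.ofReal y ≤ f x}

theorem IntervalIntegrable.of_mem_Icc {E : Type*} [NormedAddCommGroup E] {k : ℝ → E}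
    {a T s t : ℝ} (hk : IntervalIntegrable k volume a T) (hs : s ∈ Icc a T) (ht : t ∈ Icc a T) :
    IntervalIntegrable k volume s t := by
  refine hk.mono_set ?_
  rw [uIcc_of_le (hs.1.trans hs.2)]
  exact uIcc_subset_Icc hs ht

/-- A function which agrees on `[a, T]` with a constant plus a primitive of `φ` is continuous on
the set where that primitive is an honest integral. -/
theorem continuousOn_Icc_of_eq_primitive {a T t : ℝ} {c : ℂ} {φ F : ℝ → ℂ}
    (hF : ∀ t ∈ Icc a T, F t = c + ∫ s in a..t, φ s) (ht : t ∈ Icc a T)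
    (hφ : IntervalIntegrable φ volume a t) : ContinuousOn F (Icc a t) := by
  have h := intervalIntegral.continuousOn_primitive_interval' hφ left_mem_uIcc
  rw [uIcc_of_le ht.1] at h
  exact (continuousOn_const.add h).congr fun s hs => hF s ⟨hs.1, hs.2.trans ht.2⟩

theorem aestronglyMeasurable_of_eq_primitive {a T : ℝ} {c : ℂ} {φ F : ℝ → ℂ}
    (hF : ∀ t ∈ Icc a T, F t = c + ∫ s in a..t, φ s) :
    AEStronglyMeasurable F (volume.restrict (Icc a T)) := by
  set D := {t ∈ Icc a T | IntervalIntegrable φ volume a t} with hD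
  have hDconn : D.OrdConnected := by
    refine ⟨fun x hx y hy z hz => ⟨⟨hx.1.1.trans hz.1, hz.2.trans hy.1.2⟩, ?_⟩⟩
    refine hy.2.mono_set ?_
    rw [uIcc_of_le hy.1.1, uIcc_of_le (hx.1.1.trans hz.1)]
    exact Icc_subset_Icc_right hz.2
  have hDmeas : MeasurableSet D := hDconn.measurableSet
  have hcont : ContinuousOn F D := by
    intro t ht
    by_cases h : ∃ t' ∈ D, t < t'
    · obtain ⟨t', ht', htt'⟩ := h
      have h1 := continuousOn_Icc_of_eq_primitive hF ht'.1 ht'.2 t ⟨ht.1.1, htt'.le⟩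
      refine h1.mono_of_mem_nhdsWithin ?_
      filter_upwards [self_mem_nhdsWithin, mem_nhdsWithin_of_mem_nhds (Iio_mem_nhds htt')]
        with x hx hx' using ⟨hx.1.1, le_of_lt hx'⟩
    · push Not at h
      exact (continuousOn_Icc_of_eq_primitive hF ht.1 ht.2 t ⟨ht.1.1, le_rfl⟩).mono
        fun x hx => ⟨hx.1.1, h x hx⟩
  have hunion : Icc a T = D ∪ (Icc a T \ D) := by
    rw [union_sdiff_cancel]; exact fun x hx => hx.1
  rw [hunion, aestronglyMeasurable_union_iff]
  refine ⟨hcont.aestronglyMeasurable hDmeas, ?_⟩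
  refine (aestronglyMeasurable_const (b := c)).congr ?_
  refine (ae_restrict_iff' (measurableSet_Icc.diff hDmeas)).2 (Eventually.of_forall ?_)
  intro t ht
  have : ¬ IntervalIntegrable φ volume a t := fun h => ht.2 ⟨ht.1, h⟩
  rw [hF t ht.1, intervalIntegral.integral_undef this, add_zero]

theorem exists_bound_right_of_eq_primitive {a T s : ℝ} {c : ℂ} {φ F : ℝ → ℂ}
    (hF : ∀ t ∈ Icc a T, F t = c + ∫ s in a..t, φ s) (has : a ≤ s) (hsT : s < T) :
    ∃ t ∈ Ioc s T, ∃ N, ∀ x ∈ Icc s t, ‖F x‖ ≤ N := by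
  by_cases h : ∃ t ∈ Ioc s T, IntervalIntegrable φ volume a t
  · obtain ⟨t, ht, hi⟩ := h
    have hc := continuousOn_Icc_of_eq_primitive hF ⟨has.trans ht.1.le, ht.2⟩ hi
    obtain ⟨N, hN⟩ := isCompact_Icc.exists_bound_of_continuousOn hc
    exact ⟨t, ht, N, fun x hx => hN x ⟨has.trans hx.1, hx.2⟩⟩
  · push Not at h
    refine ⟨T, ⟨hsT, le_rfl⟩, max ‖F s‖ ‖c‖, fun x hx => ?_⟩
    rcases hx.1.eq_or_lt with rfl | hlt
    · exact le_max_left _ _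
    · rw [hF x ⟨has.trans hx.1, hx.2⟩, intervalIntegral.integral_undef (h x ⟨hlt, hx.2⟩), add_zero]
      exact le_max_right _ _

theorem intervalIntegrable_bdd_mul {a t N : ℝ} {f k : ℝ → ℂ} (hat : a ≤ t)
    (hf : AEStronglyMeasurable f (volume.restrict (Icc a t)))
    (hN : ∀ x ∈ Icc a t, ‖f x‖ ≤ N) (hk : IntervalIntegrable k volume a t) :
    IntervalIntegrable (fun s => f s * k s) volume a t := by
  rw [intervalIntegrable_iff_integrableOn_Ioc_of_le hat] at hk ⊢
  refine Integrable.bdd_mul (c := N) hk (hf.mono_set Ioc_subset_Icc_self) ?_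
  exact (ae_restrict_iff' measurableSet_Ioc).2
    (Eventually.of_forall fun x hx => hN x (Ioc_subset_Icc_self hx))

/-- Solutions of a linear Volterra system of size two have integrable right-hand sides, even if
the integral is only understood in the sense of the total Bochner integral. -/
theorem intervalIntegrable_of_volterra {a T : ℝ} (haT : a ≤ T) {k11 k12 k21 k22 p q : ℝ → ℂ}
    {c1 c2 : ℂ} (h11 : IntervalIntegrable k11 volume a T) (h12 : IntervalIntegrable k12 volume a T)
    (h21 : IntervalIntegrable k21 volume a T) (h22 : IntervalIntegrable k22 volume a T)
    (hp : ∀ t ∈ Icc a T, p t = c1 + ∫ s in a..t, (p s * k11 s + q s * k21 s))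
    (hq : ∀ t ∈ Icc a T, q t = c2 + ∫ s in a..t, (p s * k12 s + q s * k22 s)) :
    IntervalIntegrable (fun s => p s * k11 s + q s * k21 s) volume a T ∧
      IntervalIntegrable (fun s => p s * k12 s + q s * k22 s) volume a T ∧
      ContinuousOn p (Icc a T) ∧ ContinuousOn q (Icc a T) := by
  have mp := aestronglyMeasurable_of_eq_primitive hp
  have mq := aestronglyMeasurable_of_eq_primitive hq
  set S := {s ∈ Icc a T | ∃ N, ∀ t ∈ Icc a s, ‖p t‖ ≤ N ∧ ‖q t‖ ≤ N} with hS
  have hint : ∀ s ∈ S, IntervalIntegrable (fun s => p s * k11 s + q s * k21 s) volume a s ∧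
      IntervalIntegrable (fun s => p s * k12 s + q s * k22 s) volume a s := by
    rintro s ⟨hs, N, hN⟩
    have hsub : Icc a s ⊆ Icc a T := Icc_subset_Icc_right hs.2
    have ha : a ∈ Icc a T := ⟨le_rfl, haT⟩
    have P := fun {k} (hk : IntervalIntegrable k volume a T) =>
      intervalIntegrable_bdd_mul hs.1 (mp.mono_set hsub) (fun x hx => (hN x hx).1) (hk.of_mem_Icc ha hs)
    have Q := fun {k} (hk : IntervalIntegrable k volume a T) =>
      intervalIntegrable_bdd_mul hs.1 (mq.mono_set hsub) (fun x hx => (hN x hx).2) (hk.of_mem_Icc ha hs)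
    exact ⟨(P h11).add (Q h21), (P h12).add (Q h22)⟩
  have haS : a ∈ S := by
    refine ⟨⟨le_rfl, haT⟩, max ‖p a‖ ‖q a‖, fun t ht => ?_⟩
    obtain rfl : t = a := le_antisymm ht.2 ht.1
    exact ⟨le_max_left _ _, le_max_right _ _⟩
  have hbdd : BddAbove S := ⟨T, fun s hs => hs.1.2⟩
  set σ := sSup S with hσ
  have haσ : a ≤ σ := le_csSup hbdd haS
  have hσT : σ ≤ T := csSup_le ⟨a, haS⟩ fun s hs => hs.1.2
  have hlt : ∀ s, a ≤ s → s < σ → s ∈ S := by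
    intro s has hs
    obtain ⟨u, hu, hsu⟩ := exists_lt_of_lt_csSup ⟨a, haS⟩ hs
    obtain ⟨N, hN⟩ := hu.2
    exact ⟨⟨has, hsu.le.trans hu.1.2⟩, N, fun t ht => hN t ⟨ht.1, ht.2.trans hsu.le⟩⟩
  have hσS : σ ∈ S := by
    rcases haσ.eq_or_lt with h | haσ'
    · rw [← h]; exact haS
    set k : ℝ → ℝ := fun s => ‖k11 s‖ + ‖k12 s‖ + ‖k21 s‖ + ‖k22 s‖ with hk
    have hkint : IntervalIntegrable k volume a T :=
      ((h11.norm.add h12.norm).add h21.norm).add h22.norm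
    have hkσ : IntervalIntegrable k volume a σ := hkint.mono_set (by
      rw [uIcc_of_le haT, uIcc_of_le haσ]; exact Icc_subset_Icc_right hσT)
    have hkc := intervalIntegral.continuousOn_primitive_interval' hkσ left_mem_uIcc
    rw [uIcc_of_le haσ] at hkc
    have hev : ∀ᶠ s in 𝓝[Icc a σ] σ, (∫ x in a..σ, k x) - 1 / 2 < ∫ x in a..s, k x :=
      (hkc σ ⟨haσ, le_rfl⟩).eventually (lt_mem_nhds (by linarith))
    have hev2 : ∀ᶠ s in 𝓝[<] σ, s ∈ Ioo a σ ∧ (∫ x in a..σ, k x) - 1 / 2 < ∫ x in a..s, k x := by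
      have : 𝓝[Ioo a σ] σ = 𝓝[<] σ := nhdsWithin_Ioo_eq_nhdsLT haσ'
      rw [← this]
      filter_upwards [self_mem_nhdsWithin, nhdsWithin_mono σ Ioo_subset_Icc_self hev]
        with s h1 h2 using ⟨h1, h2⟩
    obtain ⟨s0, hs0, hs0k⟩ := hev2.exists
    obtain ⟨hs0T, N0, hN0⟩ := hlt s0 hs0.1.le hs0.2
    have key : ∀ t, s0 ≤ t → t < σ → ‖p t‖ + ‖q t‖ ≤ 2 * (‖p s0‖ + ‖q s0‖) := by
      intro t hst htσ
      have hat := hs0.1.le.trans hst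
      have htT : t ∈ Icc a T := ⟨hat, htσ.le.trans hσT⟩
      obtain ⟨i1, i2⟩ := hint t (hlt t hat htσ)
      have cp := continuousOn_Icc_of_eq_primitive hp htT i1
      have cq := continuousOn_Icc_of_eq_primitive hq htT i2
      have cG : ContinuousOn (fun x => ‖p x‖ + ‖q x‖) (Icc s0 t) :=
        (cp.norm.add cq.norm).mono (Icc_subset_Icc_left hs0.1.le)
      obtain ⟨v, hv, hmax⟩ := isCompact_Icc.exists_isMaxOn ⟨s0, ⟨le_rfl, hst⟩⟩ cG
      have hmax' : ∀ x ∈ Icc s0 t, ‖p x‖ + ‖q x‖ ≤ ‖p v‖ + ‖q v‖ := fun x hx => hmax hx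
      have hav := hs0.1.le.trans hv.1
      have hvT : v ∈ Icc a T := ⟨hav, hv.2.trans htT.2⟩
      have hsubv : uIcc s0 v ⊆ uIcc a t := by
        rw [uIcc_of_le hat, uIcc_of_le hv.1]; exact Icc_subset_Icc hs0.1.le hv.2
      have hsubv' : uIcc a s0 ⊆ uIcc a t := by
        rw [uIcc_of_le hat, uIcc_of_le hs0.1.le]; exact Icc_subset_Icc_right hst
      have dp : p v = p s0 + ∫ s in s0..v, (p s * k11 s + q s * k21 s) := by
        rw [hp v hvT, hp s0 hs0T, add_assoc, intervalIntegral.integral_add_adjacent_intervals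
          (i1.mono_set hsubv') (i1.mono_set hsubv)]
      have dq : q v = q s0 + ∫ s in s0..v, (p s * k12 s + q s * k22 s) := by
        rw [hq v hvT, hq s0 hs0T, add_assoc, intervalIntegral.integral_add_adjacent_intervals
          (i2.mono_set hsubv') (i2.mono_set hsubv)]
      have e1 : ‖∫ s in s0..v, (p s * k11 s + q s * k21 s)‖ ≤
          ∫ s in s0..v, ‖p s * k11 s + q s * k21 s‖ :=
        intervalIntegral.norm_integral_le_integral_norm hv.1
      have e2 : ‖∫ s in s0..v, (p s * k12 s + q s * k22 s)‖ ≤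
          ∫ s in s0..v, ‖p s * k12 s + q s * k22 s‖ :=
        intervalIntegral.norm_integral_le_integral_norm hv.1
      have hkv : IntervalIntegrable k volume s0 v := hkint.of_mem_Icc hs0T hvT
      have e3 : (∫ s in s0..v, ‖p s * k11 s + q s * k21 s‖) +
          (∫ s in s0..v, ‖p s * k12 s + q s * k22 s‖) ≤
          ∫ s in s0..v, (‖p v‖ + ‖q v‖) * k s := by
        rw [← intervalIntegral.integral_add (i1.mono_set hsubv).norm (i2.mono_set hsubv).norm]
        refine intervalIntegral.integral_mono_on hv.1
          ((i1.mono_set hsubv).norm.add (i2.mono_set hsubv).norm) (hkv.const_mul _) ?_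
        intro x hx
        have hm := hmax' x ⟨hx.1, hx.2.trans hv.2⟩
        have n1 : ‖p x * k11 x + q x * k21 x‖ ≤ ‖p x‖ * ‖k11 x‖ + ‖q x‖ * ‖k21 x‖ := by
          refine (norm_add_le _ _).trans ?_
          rw [norm_mul, norm_mul]
        have n2 : ‖p x * k12 x + q x * k22 x‖ ≤ ‖p x‖ * ‖k12 x‖ + ‖q x‖ * ‖k22 x‖ := by
          refine (norm_add_le _ _).trans ?_
          rw [norm_mul, norm_mul]
        have n3 : (‖p x‖ + ‖q x‖) * k x ≤ (‖p v‖ + ‖q v‖) * k x :=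
          mul_le_mul_of_nonneg_right hm (by positivity)
        refine (add_le_add n1 n2).trans (le_trans ?_ n3)
        simp only [hk]
        have := norm_nonneg (p x); have := norm_nonneg (q x)
        have := norm_nonneg (k11 x); have := norm_nonneg (k12 x)
        have := norm_nonneg (k21 x); have := norm_nonneg (k22 x)
        have : 0 ≤ ‖p x‖ * ‖k21 x‖ := by positivity
        have : 0 ≤ ‖p x‖ * ‖k22 x‖ := by positivity
        have : 0 ≤ ‖q x‖ * ‖k11 x‖ := by positivity
        have : 0 ≤ ‖q x‖ * ‖k12 x‖ := by positivity
        linarith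
      have hvσ : v < σ := hv.2.trans_lt htσ
      have e4 : ∫ s in s0..v, k s ≤ 1 / 2 := by
        have hσ' : σ ∈ Icc a T := ⟨haσ, hσT⟩
        have ha : a ∈ Icc a T := ⟨le_rfl, haT⟩
        have j1 := intervalIntegral.integral_add_adjacent_intervals
          (hkint.of_mem_Icc ha hs0T) hkv
        have j2 := intervalIntegral.integral_add_adjacent_intervals
          (hkint.of_mem_Icc ha hvT) (hkint.of_mem_Icc hvT hσ')
        have j3 : 0 ≤ ∫ s in v..σ, k s :=
          intervalIntegral.integral_nonneg hvσ.le fun x _ => by positivity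
        linarith
      rw [intervalIntegral.integral_const_mul] at e3
      have e5 : (‖p v‖ + ‖q v‖) * (∫ s in s0..v, k s) ≤ (‖p v‖ + ‖q v‖) * (1 / 2) :=
        mul_le_mul_of_nonneg_left e4 (by positivity)
      have e6 : ‖p v‖ ≤ ‖p s0‖ + ‖∫ s in s0..v, (p s * k11 s + q s * k21 s)‖ := by
        conv_lhs => rw [dp]
        exact norm_add_le _ _
      have e7 : ‖q v‖ ≤ ‖q s0‖ + ‖∫ s in s0..v, (p s * k12 s + q s * k22 s)‖ := by
        conv_lhs => rw [dq]
        exact norm_add_le _ _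
      have e8 := hmax' t ⟨hst, le_rfl⟩
      linarith
    refine ⟨⟨haσ, hσT⟩, N0 + 2 * (‖p s0‖ + ‖q s0‖) + (‖p σ‖ + ‖q σ‖), fun t ht => ?_⟩
    have hN0' : 0 ≤ N0 := (norm_nonneg _).trans (hN0 a ⟨le_rfl, hs0.1.le⟩).1
    have := norm_nonneg (p s0); have := norm_nonneg (q s0)
    have := norm_nonneg (p σ); have := norm_nonneg (q σ)
    have := norm_nonneg (p t); have := norm_nonneg (q t)
    rcases ht.2.eq_or_lt with rfl | htσ
    · constructor <;> linarith
    rcases le_total t s0 with h | h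
    · have := hN0 t ⟨ht.1, h⟩
      constructor <;> linarith
    · have := key t h htσ
      constructor <;> linarith
  have hσeq : σ = T := by
    by_contra hne
    have hσT' : σ < T := lt_of_le_of_ne hσT hne
    obtain ⟨t1, ht1, N1, hN1⟩ := exists_bound_right_of_eq_primitive hp haσ hσT'
    obtain ⟨t2, ht2, N2, hN2⟩ := exists_bound_right_of_eq_primitive hq haσ hσT'
    obtain ⟨-, N0, hN0⟩ := hσS
    have hmem : min t1 t2 ∈ S := by
      refine ⟨⟨haσ.trans (le_min ht1.1.le ht2.1.le), (min_le_left _ _).trans ht1.2⟩,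
        max N0 (max N1 N2), fun t ht => ?_⟩
      rcases le_total t σ with h | h
      · exact ⟨(hN0 t ⟨ht.1, h⟩).1.trans (le_max_left _ _),
          (hN0 t ⟨ht.1, h⟩).2.trans (le_max_left _ _)⟩
      · exact ⟨(hN1 t ⟨h, ht.2.trans (min_le_left _ _)⟩).trans
            ((le_max_left _ _).trans (le_max_right _ _)),
          (hN2 t ⟨h, ht.2.trans (min_le_right _ _)⟩).trans
            ((le_max_right _ _).trans (le_max_right _ _))⟩
    exact absurd (le_csSup hbdd hmem) (not_le.2 (lt_min ht1.1 ht2.1))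
  rw [hσeq] at hσS
  obtain ⟨i1, i2⟩ := hint T hσS
  have hT : T ∈ Icc a T := ⟨haT, le_rfl⟩
  exact ⟨i1, i2, continuousOn_Icc_of_eq_primitive hp hT i1,
    continuousOn_Icc_of_eq_primitive hq hT i2⟩

theorem integral_mul_of_primitive {a τ A B : ℝ} (haτ : a ≤ τ) {φ ψ F G : ℝ → ℝ}
    (hφ : IntervalIntegrable φ volume a τ) (hψ : IntervalIntegrable ψ volume a τ)
    (hF : ∀ t ∈ Icc a τ, F t = A + ∫ s in a..t, φ s)
    (hG : ∀ t ∈ Icc a τ, G t = B + ∫ s in a..t, ψ s) :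
    ∫ s in a..τ, (φ s * G s + F s * ψ s) = F τ * G τ - A * B := by
  have acF : AbsolutelyContinuousOnInterval (fun t => A + ∫ s in a..t, φ s) a τ :=
    ((LipschitzWith.const A).lipschitzOnWith.absolutelyContinuousOnInterval).fun_add
      (hφ.absolutelyContinuousOnInterval_intervalIntegral (c := a) (by simp))
  have acG : AbsolutelyContinuousOnInterval (fun t => B + ∫ s in a..t, ψ s) a τ :=
    ((LipschitzWith.const B).lipschitzOnWith.absolutelyContinuousOnInterval).fun_add
      (hψ.absolutelyContinuousOnInterval_intervalIntegral (c := a) (by simp))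
  have h := (acF.fun_mul acG).integral_deriv_eq_sub
  rw [intervalIntegral.integral_same, intervalIntegral.integral_same, add_zero, add_zero,
    ← hF τ ⟨haτ, le_rfl⟩, ← hG τ ⟨haτ, le_rfl⟩] at h
  rw [← h]
  apply intervalIntegral.integral_congr_ae
  filter_upwards [hφ.ae_hasDerivAt_integral, hψ.ae_hasDerivAt_integral] with x h1 h2 hx
  have hx' : x ∈ uIcc a τ := uIoc_subset_uIcc hx
  have h3 := ((h1 hx' a left_mem_uIcc).const_add A).mul ((h2 hx' a left_mem_uIcc).const_add B)
  rw [uIcc_of_le haτ] at hx'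
  rw [hF x hx', hG x hx']
  exact h3.deriv.symm

theorem norm_integral_sq_le {a t : ℝ} (hat : a ≤ t) {φ : ℝ → ℂ} {p q : ℝ → ℝ}
    (hp : IntervalIntegrable p volume a t) (hq : IntervalIntegrable q volume a t)
    (h : ∀ᵐ s ∂volume.restrict (Ioc a t), 0 ≤ p s ∧ 0 ≤ q s ∧ ‖φ s‖ ^ 2 ≤ p s * q s) :
    ‖∫ s in a..t, φ s‖ ^ 2 ≤ (∫ s in a..t, p s) * ∫ s in a..t, q s := by
  have hp0 : 0 ≤ ∫ s in a..t, p s := by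
    rw [intervalIntegral.integral_of_le hat]
    exact integral_nonneg_of_ae (h.mono fun s hs => hs.1)
  have hq0 : 0 ≤ ∫ s in a..t, q s := by
    rw [intervalIntegral.integral_of_le hat]
    exact integral_nonneg_of_ae (h.mono fun s hs => hs.2.1)
  set I := ‖∫ s in a..t, φ s‖
  have hI : 0 ≤ I := norm_nonneg _
  have key : ∀ l : ℝ, 0 < l → 2 * l * I ≤ l * l * (∫ s in a..t, p s) + ∫ s in a..t, q s := by
    intro l hl
    have h1 : I ≤ ∫ s in a..t, (l / 2 * p s + 1 / (2 * l) * q s) := by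
      refine intervalIntegral.norm_integral_le_of_norm_le hat ?_
        ((hp.const_mul _).add (hq.const_mul _))
      rw [← ae_restrict_iff' measurableSet_Ioc]
      filter_upwards [h] with s ⟨h1, h2, h3⟩
      refine abs_le_of_sq_le_sq' (a := ‖φ s‖) ?_ (by positivity) |>.2
      refine h3.trans ?_
      have : 0 ≤ (l / 2 * p s - 1 / (2 * l) * q s) ^ 2 := sq_nonneg _
      have e : l / 2 * p s * (1 / (2 * l) * q s) = p s * q s / 4 := by field_simp; ring
      nlinarith
    rw [intervalIntegral.integral_add (hp.const_mul _) (hq.const_mul _),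
      intervalIntegral.integral_const_mul, intervalIntegral.integral_const_mul] at h1
    calc 2 * l * I ≤ 2 * l * (l / 2 * (∫ s in a..t, p s) + 1 / (2 * l) * ∫ s in a..t, q s) :=
          mul_le_mul_of_nonneg_left h1 (by positivity)
      _ = _ := by field_simp
  have hd : discrim (∫ s in a..t, p s) (-(2 * I)) (∫ s in a..t, q s) ≤ 0 := by
    refine discrim_le_zero fun l => ?_
    rcases le_or_gt l 0 with hl | hl
    · have : 0 ≤ l * l * ∫ s in a..t, p s := mul_nonneg (mul_self_nonneg l) hp0
      have : 0 ≤ (-l) * I := mul_nonneg (by linarith) hI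
      linarith
    · have := key l hl
      linarith
  rw [discrim] at hd
  linarith

/-- The value of the quadratic form with matrix `[[x, w], [w, y]]` at the vector `(u, v)`. -/
def quadForm (x y w : ℝ) (u v : ℂ) : ℝ :=
  x * (u.re ^ 2 + u.im ^ 2) + 2 * w * (u.re * v.re + u.im * v.im) + y * (v.re ^ 2 + v.im ^ 2)

section Pointwise

variable {x y w : ℝ}

theorem quadratic_nonneg_of_sq_le (hx : 0 ≤ x) (hy : 0 ≤ y) (hw : w ^ 2 ≤ x * y) (s t : ℝ) :
    0 ≤ x * s ^ 2 + 2 * w * (s * t) + y * t ^ 2 := by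
  rcases hx.eq_or_lt with rfl | hx'
  · have : w = 0 := by nlinarith [sq_nonneg w]
    subst this
    have := mul_nonneg hy (sq_nonneg t)
    simpa using this
  · have h1 : 0 ≤ (x * s + w * t) ^ 2 := sq_nonneg _
    have h2 : 0 ≤ (x * y - w ^ 2) * t ^ 2 := mul_nonneg (by linarith) (sq_nonneg t)
    have h3 : 0 ≤ x * (x * s ^ 2 + 2 * w * (s * t) + y * t ^ 2) := by nlinarith
    exact nonneg_of_mul_nonneg_right h3 hx'

theorem quadForm_nonneg (hx : 0 ≤ x) (hy : 0 ≤ y) (hw : w ^ 2 ≤ x * y) (u v : ℂ) :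
    0 ≤ quadForm x y w u v := by
  have h1 := quadratic_nonneg_of_sq_le hx hy hw u.re v.re
  have h2 := quadratic_nonneg_of_sq_le hx hy hw u.im v.im
  unfold quadForm
  linarith

theorem norm_sq_row_le_left (hw : w ^ 2 ≤ x * y) (u v : ℂ) :
    ‖u * x + v * w‖ ^ 2 ≤ x * quadForm x y w u v := by
  rw [← Complex.normSq_eq_norm_sq, Complex.normSq_apply]
  simp only [Complex.add_re, Complex.add_im, Complex.mul_re, Complex.mul_im, Complex.ofReal_re,
    Complex.ofReal_im, mul_zero, sub_zero, zero_add, quadForm]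
  have := mul_le_mul_of_nonneg_right hw (add_nonneg (sq_nonneg v.re) (sq_nonneg v.im))
  nlinarith

theorem norm_sq_row_le_right (hw : w ^ 2 ≤ x * y) (u v : ℂ) :
    ‖u * w + v * y‖ ^ 2 ≤ y * quadForm x y w u v := by
  rw [← Complex.normSq_eq_norm_sq, Complex.normSq_apply]
  simp only [Complex.add_re, Complex.add_im, Complex.mul_re, Complex.mul_im, Complex.ofReal_re,
    Complex.ofReal_im, mul_zero, sub_zero, zero_add, quadForm]
  have := mul_le_mul_of_nonneg_right hw (add_nonneg (sq_nonneg u.re) (sq_nonneg u.im))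
  nlinarith

theorem quadForm_le_three_mul (hx : 0 ≤ x) (hy : 0 ≤ y) (hw : w ^ 2 ≤ x * y) (u v u' v' : ℂ) :
    quadForm x y w u' v' ≤
      3 * quadForm x y w u v + 3 * (‖u - u'‖ ^ 2 * x) + 3 * (‖v - v'‖ ^ 2 * y) := by
  have aux : ∀ s t s' t' : ℝ, x * s' ^ 2 + 2 * w * (s' * t') + y * t' ^ 2 ≤
      3 * (x * s ^ 2 + 2 * w * (s * t) + y * t ^ 2) + 3 * ((s - s') ^ 2 * x) +
        3 * ((t - t') ^ 2 * y) := by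
    intro s t s' t'
    have h1 := quadratic_nonneg_of_sq_le hx hy hw (s + (s - s')) t
    have h2 := quadratic_nonneg_of_sq_le hx hy hw s (t + (t - t'))
    have h3 := quadratic_nonneg_of_sq_le hx hy hw (s - s') (-(t - t'))
    linarith
  have h1 := aux u.re v.re u'.re v'.re
  have h2 := aux u.im v.im u'.im v'.im
  rw [← Complex.normSq_eq_norm_sq, Complex.normSq_apply, ← Complex.normSq_eq_norm_sq,
    Complex.normSq_apply]
  simp only [Complex.sub_re, Complex.sub_im, quadForm]
  linarith

theorem norm_sq_mul_le_quadForm (hx : 0 ≤ x) (hy : 0 ≤ y) (hw : w ^ 2 ≤ x * y) (u v : ℂ) :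
    ‖v‖ ^ 2 * y ≤ 2 * quadForm x y w u v + 2 * (‖u‖ ^ 2 * x) := by
  have aux : ∀ s t : ℝ, t ^ 2 * y ≤
      2 * (x * s ^ 2 + 2 * w * (s * t) + y * t ^ 2) + 2 * (s ^ 2 * x) := by
    intro s t
    have h1 := quadratic_nonneg_of_sq_le hx hy hw (2 * s) t
    linarith
  have h1 := aux u.re v.re
  have h2 := aux u.im v.im
  rw [← Complex.normSq_eq_norm_sq, Complex.normSq_apply, ← Complex.normSq_eq_norm_sq,
    Complex.normSq_apply]
  simp only [quadForm]
  linarith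

end Pointwise

/-- `[[h1, h3], [h3, h2]]` is integrable and positive semidefinite on `[a, T]`. -/
structure IsPosOn (h1 h2 h3 : ℝ → ℝ) (a T : ℝ) : Prop where
  le : a ≤ T
  int1 : IntervalIntegrable h1 volume a T
  int2 : IntervalIntegrable h2 volume a T
  int3 : IntervalIntegrable h3 volume a T
  psd : ∀ᵐ s ∂volume.restrict (Ioc a T), 0 ≤ h1 s ∧ 0 ≤ h2 s ∧ h3 s ^ 2 ≤ h1 s * h2 s

/-- `(y1, y2)` solves the canonical system with Hamiltonian `[[h1, h3], [h3, h2]]` on `[a, T]` with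
initial value `(c1, c2)`. -/
structure IsCanonicalRow (h1 h2 h3 : ℝ → ℝ) (a T : ℝ) (z c1 c2 : ℂ) (y1 y2 : ℝ → ℂ) : Prop where
  int1 : IntervalIntegrable (fun s => y1 s * h1 s + y2 s * h3 s) volume a T
  int2 : IntervalIntegrable (fun s => y1 s * h3 s + y2 s * h2 s) volume a T
  cont1 : ContinuousOn y1 (Icc a T)
  cont2 : ContinuousOn y2 (Icc a T)
  eq1 : ∀ t ∈ Icc a T, y1 t = c1 - z * ∫ s in a..t, (y1 s * h3 s + y2 s * h2 s)
  eq2 : ∀ t ∈ Icc a T, y2 t = c2 + z * ∫ s in a..t, (y1 s * h1 s + y2 s * h3 s)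

section Row

variable {h1 h2 h3 : ℝ → ℝ} {a T t r : ℝ} {z c1 c2 d1 d2 : ℂ} {y1 y2 x1 x2 : ℝ → ℂ}

theorem IsPosOn.mono (h : IsPosOn h1 h2 h3 a T) (ht : t ∈ Icc a T) : IsPosOn h1 h2 h3 a t := by
  have ha : a ∈ Icc a T := ⟨le_rfl, h.le⟩
  exact ⟨ht.1, h.int1.of_mem_Icc ha ht, h.int2.of_mem_Icc ha ht, h.int3.of_mem_Icc ha ht,
    ae_restrict_of_ae_restrict_of_subset (Ioc_subset_Ioc_right ht.2) h.psd⟩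

theorem IsCanonicalRow.mono (h : IsCanonicalRow h1 h2 h3 a T z c1 c2 y1 y2) (ht : t ∈ Icc a T) :
    IsCanonicalRow h1 h2 h3 a t z c1 c2 y1 y2 := by
  have ha : a ∈ Icc a T := ⟨le_rfl, ht.1.trans ht.2⟩
  have hs : Icc a t ⊆ Icc a T := Icc_subset_Icc_right ht.2
  exact ⟨h.int1.of_mem_Icc ha ht, h.int2.of_mem_Icc ha ht, h.cont1.mono hs, h.cont2.mono hs,
    fun s hs' => h.eq1 s (hs hs'), fun s hs' => h.eq2 s (hs hs')⟩

theorem IsCanonicalRow.sub_const_mul (hy : IsCanonicalRow h1 h2 h3 a T z c1 c2 y1 y2)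
    (hx : IsCanonicalRow h1 h2 h3 a T z d1 d2 x1 x2) (w : ℂ) :
    IsCanonicalRow h1 h2 h3 a T z (c1 - w * d1) (c2 - w * d2)
      (fun s => y1 s - w * x1 s) (fun s => y2 s - w * x2 s) := by
  have e1 : (fun s => (y1 s - w * x1 s) * (h1 s : ℂ) + (y2 s - w * x2 s) * h3 s) =
      fun s => (y1 s * h1 s + y2 s * h3 s) - w * (x1 s * h1 s + x2 s * h3 s) := by
    ext s; ring
  have e2 : (fun s => (y1 s - w * x1 s) * (h3 s : ℂ) + (y2 s - w * x2 s) * h2 s) =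
      fun s => (y1 s * h3 s + y2 s * h2 s) - w * (x1 s * h3 s + x2 s * h2 s) := by
    ext s; ring
  refine ⟨?_, ?_, hy.cont1.sub (hx.cont1.const_mul w), hy.cont2.sub (hx.cont2.const_mul w),
    fun t ht => ?_, fun t ht => ?_⟩
  · rw [e1]; exact hy.int1.sub (hx.int1.const_mul w)
  · rw [e2]; exact hy.int2.sub (hx.int2.const_mul w)
  · have ha : a ∈ Icc a T := ⟨le_rfl, ht.1.trans ht.2⟩
    rw [e2, intervalIntegral.integral_sub (hy.int2.of_mem_Icc ha ht)
      ((hx.int2.of_mem_Icc ha ht).const_mul w), intervalIntegral.integral_const_mul]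
    simp only [hy.eq1 t ht, hx.eq1 t ht]
    ring
  · have ha : a ∈ Icc a T := ⟨le_rfl, ht.1.trans ht.2⟩
    rw [e1, intervalIntegral.integral_sub (hy.int1.of_mem_Icc ha ht)
      ((hx.int1.of_mem_Icc ha ht).const_mul w), intervalIntegral.integral_const_mul]
    simp only [hy.eq2 t ht, hx.eq2 t ht]
    ring

theorem IntervalIntegrable.complex_re {φ : ℝ → ℂ} (h : IntervalIntegrable φ volume a t) :
    IntervalIntegrable (fun s => (φ s).re) volume a t := ⟨h.1.re, h.2.re⟩

theorem IntervalIntegrable.complex_im {φ : ℝ → ℂ} (h : IntervalIntegrable φ volume a t) :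
    IntervalIntegrable (fun s => (φ s).im) volume a t := ⟨h.1.im, h.2.im⟩

theorem re_intervalIntegral {φ : ℝ → ℂ} (h : IntervalIntegrable φ volume a t) :
    (∫ s in a..t, φ s).re = ∫ s in a..t, (φ s).re :=
  (Complex.reCLM.intervalIntegral_comp_comm h).symm

theorem im_intervalIntegral {φ : ℝ → ℂ} (h : IntervalIntegrable φ volume a t) :
    (∫ s in a..t, φ s).im = ∫ s in a..t, (φ s).im :=
  (Complex.imCLM.intervalIntegral_comp_comm h).symm

theorem quadForm_eq_re_mul (x y w : ℝ) (u v : ℂ) :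
    quadForm x y w u v = u.re * (u * x + v * w).re + u.im * (u * x + v * w).im +
      (v.re * (u * w + v * y).re + v.im * (u * w + v * y).im) := by
  simp only [Complex.add_re, Complex.add_im, Complex.mul_re, Complex.mul_im, Complex.ofReal_re,
    Complex.ofReal_im, quadForm]
  ring

theorem IsCanonicalRow.intervalIntegrable_quadForm
    (hy : IsCanonicalRow h1 h2 h3 a T z c1 c2 y1 y2) (haT : a ≤ T) :
    IntervalIntegrable (fun s => quadForm (h1 s) (h2 s) (h3 s) (y1 s) (y2 s)) volume a T := by
  have hc1 := hy.cont1
  have hc2 := hy.cont2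
  rw [← uIcc_of_le haT] at hc1 hc2
  simp only [quadForm_eq_re_mul]
  exact ((hy.int1.complex_re.continuousOn_mul (Complex.continuous_re.comp_continuousOn hc1)).add
    (hy.int1.complex_im.continuousOn_mul (Complex.continuous_im.comp_continuousOn hc1))).add
    ((hy.int2.complex_re.continuousOn_mul (Complex.continuous_re.comp_continuousOn hc2)).add
    (hy.int2.complex_im.continuousOn_mul (Complex.continuous_im.comp_continuousOn hc2)))

theorem IsCanonicalRow.energy (hy : IsCanonicalRow h1 h2 h3 a T (r * Complex.I) c1 c2 y1 y2)
    (haT : a ≤ T) :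
    r * ∫ s in a..T, quadForm (h1 s) (h2 s) (h3 s) (y1 s) (y2 s) =
      ((y2 T).im * (y1 T).re - (y2 T).re * (y1 T).im) - (c2.im * c1.re - c2.re * c1.im) := by
  have ha : a ∈ Icc a T := ⟨le_rfl, haT⟩
  have u1 : ∀ t ∈ Icc a T, (y1 t).re = c1.re + ∫ s in a..t,
      r * (y1 s * h3 s + y2 s * h2 s).im := fun t ht => by
    rw [intervalIntegral.integral_const_mul, ← im_intervalIntegral (hy.int2.of_mem_Icc ha ht),
      hy.eq1 t ht]
    simp
  have v1 : ∀ t ∈ Icc a T, (y1 t).im = c1.im + ∫ s in a..t,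
      (-r) * (y1 s * h3 s + y2 s * h2 s).re := fun t ht => by
    rw [intervalIntegral.integral_const_mul, ← re_intervalIntegral (hy.int2.of_mem_Icc ha ht),
      hy.eq1 t ht]
    simp [sub_eq_add_neg]
  have u2 : ∀ t ∈ Icc a T, (y2 t).re = c2.re + ∫ s in a..t,
      (-r) * (y1 s * h1 s + y2 s * h3 s).im := fun t ht => by
    rw [intervalIntegral.integral_const_mul, ← im_intervalIntegral (hy.int1.of_mem_Icc ha ht),
      hy.eq2 t ht]
    simp
  have v2 : ∀ t ∈ Icc a T, (y2 t).im = c2.im + ∫ s in a..t,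
      r * (y1 s * h1 s + y2 s * h3 s).re := fun t ht => by
    rw [intervalIntegral.integral_const_mul, ← re_intervalIntegral (hy.int1.of_mem_Icc ha ht),
      hy.eq2 t ht]
    simp
  have hc1 := hy.cont1
  have hc2 := hy.cont2
  rw [← uIcc_of_le haT] at hc1 hc2
  have i1 := hy.int1.complex_re.const_mul r
  have i2 := hy.int1.complex_im.const_mul (-r)
  have i3 := hy.int2.complex_re.const_mul (-r)
  have i4 := hy.int2.complex_im.const_mul r
  have A := integral_mul_of_primitive haT i1 i4 v2 u1
  have B := integral_mul_of_primitive haT i2 i3 u2 v1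
  have iA := (i1.mul_continuousOn (Complex.continuous_re.comp_continuousOn hc1)).add
    (i4.continuousOn_mul (Complex.continuous_im.comp_continuousOn hc2))
  have iB := (i2.mul_continuousOn (Complex.continuous_im.comp_continuousOn hc1)).add
    (i3.continuousOn_mul (Complex.continuous_re.comp_continuousOn hc2))
  have C := intervalIntegral.integral_sub iA iB
  simp only [Function.comp_apply] at C
  rw [A, B] at C
  rw [← intervalIntegral.integral_const_mul]
  calc _ = _ := by
        refine intervalIntegral.integral_congr fun s _ => ?_
        simp only [quadForm_eq_re_mul]
        ring
    _ = _ := C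
    _ = _ := by ring

theorem IsCanonicalRow.norm_sub_left_sq_le (hH : IsPosOn h1 h2 h3 a T)
    (hy : IsCanonicalRow h1 h2 h3 a T z c1 c2 y1 y2) :
    ‖y1 T - c1‖ ^ 2 ≤ ‖z‖ ^ 2 * ((∫ s in a..T, h2 s) *
      ∫ s in a..T, quadForm (h1 s) (h2 s) (h3 s) (y1 s) (y2 s)) := by
  have e : y1 T - c1 = -(z * ∫ s in a..T, (y1 s * h3 s + y2 s * h2 s)) := by
    rw [hy.eq1 T ⟨hH.le, le_rfl⟩]; ring
  rw [e, norm_neg, norm_mul, mul_pow]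
  refine mul_le_mul_of_nonneg_left ?_ (by positivity)
  refine norm_integral_sq_le hH.le hH.int2 (hy.intervalIntegrable_quadForm hH.le) ?_
  filter_upwards [hH.psd] with s ⟨p1, p2, p3⟩
  exact ⟨p2, quadForm_nonneg p1 p2 p3 _ _, norm_sq_row_le_right p3 _ _⟩

theorem IsCanonicalRow.norm_sub_right_sq_le (hH : IsPosOn h1 h2 h3 a T)
    (hy : IsCanonicalRow h1 h2 h3 a T z c1 c2 y1 y2) :
    ‖y2 T - c2‖ ^ 2 ≤ ‖z‖ ^ 2 * ((∫ s in a..T, h1 s) *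
      ∫ s in a..T, quadForm (h1 s) (h2 s) (h3 s) (y1 s) (y2 s)) := by
  have e : y2 T - c2 = z * ∫ s in a..T, (y1 s * h1 s + y2 s * h3 s) := by
    rw [hy.eq2 T ⟨hH.le, le_rfl⟩]; ring
  rw [e, norm_mul, mul_pow]
  refine mul_le_mul_of_nonneg_left ?_ (by positivity)
  refine norm_integral_sq_le hH.le hH.int1 (hy.intervalIntegrable_quadForm hH.le) ?_
  filter_upwards [hH.psd] with s ⟨p1, p2, p3⟩
  exact ⟨p1, quadForm_nonneg p1 p2 p3 _ _, norm_sq_row_le_left p3 _ _⟩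

theorem integral_mono_right {f : ℝ → ℝ} (ht : t ∈ Icc a T) (hf : IntervalIntegrable f volume a T)
    (h0 : ∀ᵐ s ∂volume.restrict (Ioc a T), 0 ≤ f s) :
    ∫ s in a..t, f s ≤ ∫ s in a..T, f s :=
  intervalIntegral.integral_mono_interval le_rfl ht.1 ht.2 h0 hf

theorem IsPosOn.integral_quadForm (hH : IsPosOn h1 h2 h3 a T) (u v : ℂ) :
    ∫ s in a..T, quadForm (h1 s) (h2 s) (h3 s) u v =
      quadForm (∫ s in a..T, h1 s) (∫ s in a..T, h2 s) (∫ s in a..T, h3 s) u v := by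
  unfold quadForm
  have i3 := (hH.int3.const_mul 2).mul_const (u.re * v.re + u.im * v.im)
  rw [intervalIntegral.integral_add ((hH.int1.mul_const _).add i3) (hH.int2.mul_const _),
    intervalIntegral.integral_add (hH.int1.mul_const _) i3]
  simp only [intervalIntegral.integral_mul_const, intervalIntegral.integral_const_mul]

theorem IsPosOn.intervalIntegrable_quadForm (hH : IsPosOn h1 h2 h3 a T) (u v : ℂ) :
    IntervalIntegrable (fun s => quadForm (h1 s) (h2 s) (h3 s) u v) volume a T :=
  ((hH.int1.mul_const _).add ((hH.int3.const_mul 2).mul_const _)).add (hH.int2.mul_const _)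

theorem IsPosOn.sq_integral_le (hH : IsPosOn h1 h2 h3 a T) :
    (∫ s in a..T, h3 s) ^ 2 ≤ (∫ s in a..T, h1 s) * ∫ s in a..T, h2 s := by
  have h := norm_integral_sq_le (φ := fun s => (h3 s : ℂ)) hH.le hH.int1 hH.int2
    (hH.psd.mono fun s hs => ⟨hs.1, hs.2.1, by simpa using hs.2.2⟩)
  rwa [intervalIntegral.integral_ofReal, Complex.norm_real, Real.norm_eq_abs, sq_abs] at h

theorem IsPosOn.integral_left_nonneg (hH : IsPosOn h1 h2 h3 a T) : 0 ≤ ∫ s in a..T, h1 s := by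
  rw [intervalIntegral.integral_of_le hH.le]
  exact integral_nonneg_of_ae (hH.psd.mono fun s hs => hs.1)

theorem IsPosOn.integral_right_nonneg (hH : IsPosOn h1 h2 h3 a T) : 0 ≤ ∫ s in a..T, h2 s := by
  rw [intervalIntegral.integral_of_le hH.le]
  exact integral_nonneg_of_ae (hH.psd.mono fun s hs => hs.2.1)

/-- The quadratic form of `∫ H` at the initial value is controlled by the energy of a solution. -/
theorem IsCanonicalRow.quadForm_initial_le (hH : IsPosOn h1 h2 h3 a T)
    (hy : IsCanonicalRow h1 h2 h3 a T z c1 c2 y1 y2) :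
    quadForm (∫ s in a..T, h1 s) (∫ s in a..T, h2 s) (∫ s in a..T, h3 s) c1 c2 ≤
      (3 + 6 * (‖z‖ ^ 2 * ((∫ s in a..T, h1 s) * ∫ s in a..T, h2 s))) *
        ∫ s in a..T, quadForm (h1 s) (h2 s) (h3 s) (y1 s) (y2 s) := by
  set m1 := ∫ s in a..T, h1 s with hm1
  set m2 := ∫ s in a..T, h2 s with hm2
  set P := ∫ s in a..T, quadForm (h1 s) (h2 s) (h3 s) (y1 s) (y2 s) with hP
  have iP := hy.intervalIntegrable_quadForm hH.le
  have m1n : 0 ≤ m1 := hH.integral_left_nonneg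
  have m2n : 0 ≤ m2 := hH.integral_right_nonneg
  have mono : ∀ t ∈ Icc a T, (∫ s in a..t, h1 s) ≤ m1 ∧ (∫ s in a..t, h2 s) ≤ m2 ∧
      0 ≤ (∫ s in a..t, quadForm (h1 s) (h2 s) (h3 s) (y1 s) (y2 s)) ∧
      (∫ s in a..t, quadForm (h1 s) (h2 s) (h3 s) (y1 s) (y2 s)) ≤ P := by
    intro t ht
    refine ⟨integral_mono_right ht hH.int1 (hH.psd.mono fun s hs => hs.1),
      integral_mono_right ht hH.int2 (hH.psd.mono fun s hs => hs.2.1), ?_,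
      integral_mono_right ht iP (hH.psd.mono fun s hs => quadForm_nonneg hs.1 hs.2.1 hs.2.2 _ _)⟩
    rw [intervalIntegral.integral_of_le ht.1]
    exact integral_nonneg_of_ae ((hH.mono ht).psd.mono fun s hs =>
      quadForm_nonneg hs.1 hs.2.1 hs.2.2 _ _)
  have d1 : ∀ t ∈ Icc a T, ‖y1 t - c1‖ ^ 2 ≤ ‖z‖ ^ 2 * (m2 * P) := fun t ht => by
    obtain ⟨-, b2, b3, b4⟩ := mono t ht
    exact ((hy.mono ht).norm_sub_left_sq_le (hH.mono ht)).trans (by gcongr)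
  have d2 : ∀ t ∈ Icc a T, ‖y2 t - c2‖ ^ 2 ≤ ‖z‖ ^ 2 * (m1 * P) := fun t ht => by
    obtain ⟨b1, -, b3, b4⟩ := mono t ht
    exact ((hy.mono ht).norm_sub_right_sq_le (hH.mono ht)).trans (by gcongr)
  have i1 := hH.int1.const_mul (3 * (‖z‖ ^ 2 * (m2 * P)))
  have i2 := hH.int2.const_mul (3 * (‖z‖ ^ 2 * (m1 * P)))
  rw [← hH.integral_quadForm]
  have key : ∫ s in a..T, quadForm (h1 s) (h2 s) (h3 s) c1 c2 ≤
      ∫ s in a..T, (3 * quadForm (h1 s) (h2 s) (h3 s) (y1 s) (y2 s) +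
        3 * (‖z‖ ^ 2 * (m2 * P)) * h1 s + 3 * (‖z‖ ^ 2 * (m1 * P)) * h2 s) := by
    rw [intervalIntegral.integral_of_le hH.le, intervalIntegral.integral_of_le hH.le]
    refine integral_mono_ae (hH.intervalIntegrable_quadForm c1 c2).1
      (((iP.const_mul 3).add i1).add i2).1 ?_
    filter_upwards [hH.psd, ae_restrict_mem measurableSet_Ioc] with s ⟨p1, p2, p3⟩ hs
    have e1 := mul_le_mul_of_nonneg_right (d1 s (Ioc_subset_Icc_self hs)) p1
    have e2 := mul_le_mul_of_nonneg_right (d2 s (Ioc_subset_Icc_self hs)) p2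
    have := quadForm_le_three_mul p1 p2 p3 (y1 s) (y2 s) c1 c2
    linarith
  refine key.trans (le_of_eq ?_)
  rw [intervalIntegral.integral_add ((iP.const_mul 3).add i1) i2,
    intervalIntegral.integral_add (iP.const_mul 3) i1, intervalIntegral.integral_const_mul,
    intervalIntegral.integral_const_mul, intervalIntegral.integral_const_mul]
  ring

end Row

section Weyl

variable {a : ℝ} {b : EReal} {H : ℝ → Matrix (Fin 2) (Fin 2) ℝ} {T t r : ℝ} {z : ℂ}
  {W : ℝ → ℂ → Matrix (Fin 2) (Fin 2) ℂ}

theorem IsHamiltonian.ae_Ioc (hH : IsHamiltonian a b H) (hTb : (T : EReal) < b) :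
    ∀ᵐ s ∂volume.restrict (Ioc a T), (H s).PosSemidef := by
  rw [ae_restrict_iff' measurableSet_Ioc]
  filter_upwards [hH.posSemidef] with s hs hsT
  exact hs hsT.1.le (lt_of_le_of_lt (EReal.coe_le_coe_iff.2 hsT.2) hTb)

theorem IsHamiltonian.isPosOn (hH : IsHamiltonian a b H) (haT : a ≤ T) (hTb : (T : EReal) < b) :
    IsPosOn (fun s => H s 0 0) (fun s => H s 1 1) (fun s => H s 0 1) a T := by
  refine ⟨haT, hH.locInt 0 0 T haT hTb, hH.locInt 1 1 T haT hTb, hH.locInt 0 1 T haT hTb, ?_⟩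
  filter_upwards [hH.ae_Ioc hTb] with s hs
  refine ⟨hs.diag_nonneg, hs.diag_nonneg, ?_⟩
  have h1 := hs.det_nonneg
  have h2 : H s 1 0 = H s 0 1 := by simpa using hs.isHermitian.apply 0 1
  rw [Matrix.det_fin_two, h2] at h1
  nlinarith

theorem IsFundamentalSolution.isCanonicalRow (hH : IsHamiltonian a b H)
    (hW : IsFundamentalSolution a b H W) (haT : a ≤ T) (hTb : (T : EReal) < b) (i : Fin 2) :
    IsCanonicalRow (fun s => H s 0 0) (fun s => H s 1 1) (fun s => H s 0 1) a T z
      ((1 : Matrix (Fin 2) (Fin 2) ℂ) i 0) ((1 : Matrix (Fin 2) (Fin 2) ℂ) i 1)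
      (fun s => W s z i 0) (fun s => W s z i 1) := by
  have hlt : ∀ t ∈ Icc a T, (t : EReal) < b := fun t ht =>
    lt_of_le_of_lt (EReal.coe_le_coe_iff.2 ht.2) hTb
  have hsymm : ∀ᵐ s, s ∈ Ioc a T → H s 1 0 = H s 0 1 := by
    rw [← ae_restrict_iff' measurableSet_Ioc]
    filter_upwards [hH.ae_Ioc hTb] with s hs
    simpa using hs.isHermitian.apply 0 1
  have E2 : ∀ t ∈ Icc a T, W t z i 1 = (1 : Matrix (Fin 2) (Fin 2) ℂ) i 1 +
      z * ∫ s in a..t, (W s z i 0 * (H s 0 0 : ℝ) + W s z i 1 * (H s 0 1 : ℝ)) := by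
    intro t ht
    have h := congrFun (congrFun (hW z t ht.1 (hlt t ht)) i) 0
    have hc : ∫ s in a..t, (W s z * (H s).map (fun x : ℝ => (x : ℂ))) i 0 =
        ∫ s in a..t, (W s z i 0 * (H s 0 0 : ℝ) + W s z i 1 * (H s 0 1 : ℝ)) := by
      refine intervalIntegral.integral_congr_ae ?_
      filter_upwards [hsymm] with s hs hst
      rw [uIoc_of_le ht.1] at hst
      rw [← hs ⟨hst.1, hst.2.trans ht.2⟩]
      simp [Matrix.mul_apply, Fin.sum_univ_two]
    rw [Matrix.smul_apply, Matrix.of_apply, hc, smul_eq_mul] at h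
    rw [← h]
    obtain rfl | rfl : i = 0 ∨ i = 1 := by omega
    all_goals simp [JmatC, Matrix.mul_apply, Fin.sum_univ_two]
  have E1 : ∀ t ∈ Icc a T, W t z i 0 = (1 : Matrix (Fin 2) (Fin 2) ℂ) i 0 -
      z * ∫ s in a..t, (W s z i 0 * (H s 0 1 : ℝ) + W s z i 1 * (H s 1 1 : ℝ)) := by
    intro t ht
    have h := congrFun (congrFun (hW z t ht.1 (hlt t ht)) i) 1
    have hc : ∫ s in a..t, (W s z * (H s).map (fun x : ℝ => (x : ℂ))) i 1 =
        ∫ s in a..t, (W s z i 0 * (H s 0 1 : ℝ) + W s z i 1 * (H s 1 1 : ℝ)) := by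
      refine intervalIntegral.integral_congr fun s _ => ?_
      simp [Matrix.mul_apply, Fin.sum_univ_two]
    rw [Matrix.smul_apply, Matrix.of_apply, hc, smul_eq_mul] at h
    rw [← h]
    obtain rfl | rfl : i = 0 ∨ i = 1 := by omega
    all_goals simp [JmatC, Matrix.mul_apply, Fin.sum_univ_two]
  have I : ∀ j k, IntervalIntegrable (fun s => ((H s j k : ℝ) : ℂ)) volume a T := fun j k =>
    ⟨(hH.locInt j k T haT hTb).1.ofReal, (hH.locInt j k T haT hTb).2.ofReal⟩
  by_cases hz : z = 0
  · subst hz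
    simp only [zero_mul, add_zero, sub_zero] at E1 E2
    have c1 : ContinuousOn (fun s => W s 0 i 0) (Icc a T) := continuousOn_const.congr E1
    have c2 : ContinuousOn (fun s => W s 0 i 1) (Icc a T) := continuousOn_const.congr E2
    have c1' := c1
    have c2' := c2
    rw [← uIcc_of_le haT] at c1' c2'
    exact ⟨((I 0 0).continuousOn_mul c1').add ((I 0 1).continuousOn_mul c2'),
      ((I 0 1).continuousOn_mul c1').add ((I 1 1).continuousOn_mul c2'), c1, c2,
      fun t ht => by rw [zero_mul, sub_zero]; exact E1 t ht,
      fun t ht => by rw [zero_mul, add_zero]; exact E2 t ht⟩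
  · have V := intervalIntegrable_of_volterra haT (p := fun s => W s z i 0)
      (q := fun s => W s z i 1) (c1 := (1 : Matrix (Fin 2) (Fin 2) ℂ) i 0)
      (c2 := (1 : Matrix (Fin 2) (Fin 2) ℂ) i 1)
      ((I 0 1).const_mul (-z)) ((I 0 0).const_mul z) ((I 1 1).const_mul (-z))
      ((I 0 1).const_mul z)
      (fun t ht => by
        simp only [E1 t ht, sub_eq_add_neg, ← neg_mul]
        rw [← intervalIntegral.integral_const_mul]
        congr 1
        refine intervalIntegral.integral_congr fun s _ => ?_
        ring)
      (fun t ht => by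
        simp only [E2 t ht]
        rw [← intervalIntegral.integral_const_mul]
        congr 1
        refine intervalIntegral.integral_congr fun s _ => ?_
        ring)
    obtain ⟨i1, i2, c1, c2⟩ := V
    refine ⟨?_, ?_, c1, c2, E1, E2⟩
    · refine (i2.const_mul z⁻¹).congr (fun s _ => ?_)
      field_simp
    · refine (i1.const_mul (-z)⁻¹).congr (fun s _ => ?_)
      field_simp
      ring

theorem toBFilter_neBot (hab : (a : EReal) < b) : (toBFilter b).NeBot := by
  refine comap_neBot_iff.2 fun s hs => ?_
  obtain ⟨l, hl, hls⟩ := (mem_nhdsLT_iff_exists_Ioo_subset' hab).1 hs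
  obtain ⟨x, hx1, hx2⟩ := EReal.lt_iff_exists_real_btwn.1 hl
  exact ⟨x, hls ⟨hx1, hx2⟩⟩

theorem eventually_toBFilter (htb : (t : EReal) < b) :
    ∀ᶠ T in toBFilter b, t ≤ T ∧ (T : EReal) < b := by
  have h : ∀ᶠ x in 𝓝[<] b, (t : EReal) < x ∧ x < b := Ioo_mem_nhdsLT htb
  filter_upwards [h.comap (fun t : ℝ => (t : EReal))] with T hT
  exact ⟨EReal.coe_le_coe_iff.1 hT.1.le, hT.2⟩

/-- Comparison of the quadratic form of `M(t)` at the Weyl solution with the imaginary part of the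
Weyl coefficient on the imaginary axis. -/
theorem IsFundamentalSolution.quadForm_weyl_le (hH : IsHamiltonian a b H)
    (hW : IsFundamentalSolution a b H W) (hr : 0 < r) {q : ℂ}
    (hq : Tendsto (fun t => W t (r * Complex.I) 0 1 / W t (r * Complex.I) 1 1)
      (toBFilter b) (𝓝 q))
    (hat : a ≤ t) (htb : (t : EReal) < b) :
    quadForm (m1 a H t) (m2 a H t) (m3 a H t) 1 (-q) ≤
      (3 + 6 * (r ^ 2 * (m1 a H t * m2 a H t))) * (q.im / r) := by
  have := toBFilter_neBot hH.a_lt_b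
  set z : ℂ := r * Complex.I with hz
  have hznorm : ‖z‖ ^ 2 = r ^ 2 := by simp [hz]
  have hnn := (hH.isPosOn hat htb)
  have m1n : 0 ≤ m1 a H t := hnn.integral_left_nonneg
  have m2n : 0 ≤ m2 a H t := hnn.integral_right_nonneg
  have main : ∀ᶠ T in toBFilter b,
      quadForm (m1 a H t) (m2 a H t) (m3 a H t) 1 (-(W T z 0 1 / W T z 1 1)) ≤
      (3 + 6 * (r ^ 2 * (m1 a H t * m2 a H t))) * ((W T z 0 1 / W T z 1 1).im / r) := by
    filter_upwards [eventually_toBFilter htb] with T ⟨htT, hTb⟩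
    have haT := hat.trans htT
    have hP := hH.isPosOn haT hTb
    have R0 := hW.isCanonicalRow (z := z) hH haT hTb 0
    have R1 := hW.isCanonicalRow (z := z) hH haT hTb 1
    have hne : W T z 1 1 ≠ 0 := by
      intro h0
      have e := R1.energy haT
      simp only [h0] at e
      have e0 : r * ∫ s in a..T, quadForm (H s 0 0) (H s 1 1) (H s 0 1) (W s z 1 0) (W s z 1 1)
          = 0 := by rw [e]; simp
      have e1 := (mul_eq_zero.1 e0).resolve_left hr.ne'
      have d := R1.norm_sub_right_sq_le hP
      simp only [h0, e1] at d
      norm_num at d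
    set w := W T z 0 1 / W T z 1 1 with hw
    have R := R0.sub_const_mul R1 w
    have y2T : W T z 0 1 - w * W T z 1 1 = 0 := by rw [hw]; field_simp; ring
    have e := R.energy haT
    simp only [y2T] at e
    have hT : t ∈ Icc a T := ⟨hat, htT⟩
    have q1 := (R.mono hT).quadForm_initial_le (hP.mono hT)
    have q2 := integral_mono_right hT (R.intervalIntegrable_quadForm haT)
      (hP.psd.mono fun s hs => quadForm_nonneg hs.1 hs.2.1 hs.2.2 _ _)
    have c1 : (1 : Matrix (Fin 2) (Fin 2) ℂ) 0 0 - w * (1 : Matrix (Fin 2) (Fin 2) ℂ) 1 0 = 1 := by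
      simp
    have c2 : (1 : Matrix (Fin 2) (Fin 2) ℂ) 0 1 - w * (1 : Matrix (Fin 2) (Fin 2) ℂ) 1 1 = -w := by
      simp
    rw [c1, c2, hznorm] at q1
    rw [c1, c2] at e
    refine q1.trans (mul_le_mul_of_nonneg_left (q2.trans (le_of_eq ?_)) (by positivity))
    rw [eq_div_iff hr.ne', mul_comm, e]
    simp
  refine le_of_tendsto_of_tendsto ?_ ?_ main
  · have hc : Continuous fun q : ℂ => quadForm (m1 a H t) (m2 a H t) (m3 a H t) 1 (-q) := by
      unfold quadForm
      fun_prop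
    exact (hc.tendsto q).comp hq
  · have hc : Continuous fun q : ℂ =>
        (3 + 6 * (r ^ 2 * (m1 a H t * m2 a H t))) * (q.im / r) := by
      fun_prop
    exact (hc.tendsto q).comp hq

theorem IsHamiltonian.det_nonneg (hH : IsHamiltonian a b H) (hat : a ≤ t)
    (htb : (t : EReal) < b) : 0 ≤ (Mmat a H t).det := by
  have h := (hH.isPosOn hat htb).sq_integral_le
  rw [Mmat, Matrix.det_fin_two_of]
  simp only [m1, m2, m3]
  linarith

theorem det_div_le_of_quadForm_le {x y w e : ℝ} (hy : 0 < y) {q : ℂ}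
    (h : quadForm x y w 1 (-q) ≤ e) : (x * y - w * w) / y ≤ e := by
  refine le_trans ?_ h
  rw [div_le_iff₀ hy]
  simp only [quadForm, Complex.one_re, Complex.one_im, Complex.neg_re, Complex.neg_im]
  nlinarith [sq_nonneg (w - y * q.re), sq_nonneg (y * q.im)]

/-- Two-sided estimate for the Weyl coefficient at `ir`, where `r` and `t` are related by
`r² (m1 m2)(t) = 1`. -/
theorem IsFundamentalSolution.weyl_bounds (hH : IsHamiltonian a b H)
    (hW : IsFundamentalSolution a b H W) (hr : 0 < r) {q : ℂ}
    (hq : Tendsto (fun t => W t (r * Complex.I) 0 1 / W t (r * Complex.I) 1 1)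
      (toBFilter b) (𝓝 q))
    (hat : a ≤ t) (htb : (t : EReal) < b) (hrt : r ^ 2 * (m1 a H t * m2 a H t) = 1) :
    (Mmat a H t).det / m2 a H t ≤ 9 * (q.im / r) ∧ q.im ≤ 19 * (r * m1 a H t) := by
  have hE := hW.quadForm_weyl_le hH hr hq hat htb
  have hP := hH.isPosOn hat htb
  have m1n : 0 ≤ m1 a H t := hP.integral_left_nonneg
  have m2n : 0 ≤ m2 a H t := hP.integral_right_nonneg
  have hpos : 0 < m1 a H t * m2 a H t :=
    (mul_nonneg m1n m2n).lt_of_ne fun h => by simp [← h] at hrt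
  have m1p : 0 < m1 a H t := m1n.lt_of_ne fun h => by simp [← h] at hpos
  have m2p : 0 < m2 a H t := m2n.lt_of_ne fun h => by simp [← h] at hpos
  rw [hrt] at hE
  norm_num at hE
  constructor
  · rw [Mmat, Matrix.det_fin_two_of]
    exact det_div_le_of_quadForm_le m2p hE
  · have h1 := norm_sq_mul_le_quadForm m1n m2n hP.sq_integral_le 1 (-q)
    have h2 : ‖q‖ ^ 2 * m2 a H t ≤ 2 * (9 * (q.im / r)) + 2 * m1 a H t := by
      have h1' : ‖q‖ ^ 2 * m2 a H t ≤
          2 * quadForm (m1 a H t) (m2 a H t) (m3 a H t) 1 (-q) + 2 * m1 a H t := by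
        simpa [m1, m2, m3] using h1
      linarith
    set x := r * m1 a H t with hx
    have hxp : 0 < x := mul_pos hr m1p
    have hqi : q.im ≤ ‖q‖ := (le_abs_self _).trans (Complex.abs_im_le_norm q)
    refine hqi.trans ?_
    have h3 : ‖q‖ ^ 2 ≤ 18 * ‖q‖ * x + 2 * x ^ 2 := by
      have h4 : ‖q‖ ^ 2 * m2 a H t * (r * x) ≤ (2 * (9 * (‖q‖ / r)) + 2 * m1 a H t) * (r * x) := by
        refine mul_le_mul_of_nonneg_right (h2.trans ?_) (by positivity)
        gcongr
      have h5 : ‖q‖ ^ 2 * m2 a H t * (r * x) = ‖q‖ ^ 2 := by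
        rw [hx]; linear_combination ‖q‖ ^ 2 * hrt
      have h6 : (2 * (9 * (‖q‖ / r)) + 2 * m1 a H t) * (r * x) = 18 * ‖q‖ * x + 2 * x ^ 2 := by
        rw [hx]; field_simp; ring
      linarith
    by_contra! hcon
    nlinarith [norm_nonneg q]

end Weyl

section Poisson

variable {μ : Measure ℝ} {r : ℝ}

theorem integrable_one_div_one_add_sq
    (hμ : (∫⁻ t : ℝ, ENNReal.ofReal (1 / (1 + t ^ 2)) ∂μ) < ⊤) :
    Integrable (fun t : ℝ => 1 / (1 + t ^ 2)) μ := by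
  refine ⟨Measurable.aestronglyMeasurable (by fun_prop), ?_⟩
  rw [hasFiniteIntegral_iff_ofReal (Eventually.of_forall fun t => by positivity)]
  exact hμ

theorem integrable_poisson_kernel (hμ : Integrable (fun t : ℝ => 1 / (1 + t ^ 2)) μ)
    (hr : 0 < r) : Integrable (fun t : ℝ => r / (t ^ 2 + r ^ 2)) μ := by
  refine (hμ.const_mul (r + 1 / r)).mono'
    (Measurable.aestronglyMeasurable (by fun_prop)) (Eventually.of_forall fun t => ?_)
  have h0 : 0 < t ^ 2 + r ^ 2 := by positivity
  rw [Real.norm_of_nonneg (by positivity), mul_one_div, div_le_div_iff₀ h0 (by positivity)]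
  have : (r + 1 / r) * (t ^ 2 + r ^ 2) = r * (1 + t ^ 2) + (r ^ 3 + t ^ 2 / r) := by
    field_simp
    ring
  rw [this]
  have : 0 ≤ r ^ 3 + t ^ 2 / r := by positivity
  linarith

theorem im_integral_herglotz_kernel (hμ : Integrable (fun t : ℝ => 1 / (1 + t ^ 2)) μ)
    (hr : 0 < r) :
    (∫ t : ℝ, (1 / ((t : ℂ) - r * Complex.I) - (t : ℂ) / (1 + (t : ℂ) ^ 2)) ∂μ).im =
      ∫ t : ℝ, r / (t ^ 2 + r ^ 2) ∂μ := by
  have hre : Integrable (fun t : ℝ => t * (1 - r ^ 2) / ((t ^ 2 + r ^ 2) * (1 + t ^ 2))) μ := by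
    refine (hμ.const_mul (|1 - r ^ 2| / r)).mono'
      (Measurable.aestronglyMeasurable (by fun_prop)) (Eventually.of_forall fun t => ?_)
    have h0 : 0 < t ^ 2 + r ^ 2 := by positivity
    have h1 : 0 < 1 + t ^ 2 := by positivity
    rw [Real.norm_eq_abs, abs_div, abs_mul, abs_of_pos (mul_pos h0 h1), div_mul_div_comm, mul_one,
      div_le_div_iff₀ (by positivity) (by positivity)]
    have h2 : |t| * r ≤ t ^ 2 + r ^ 2 := by
      nlinarith [sq_nonneg (|t| - r), sq_abs t, sq_nonneg t, sq_nonneg r]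
    nlinarith [mul_le_mul_of_nonneg_left h2 (mul_nonneg (abs_nonneg (1 - r ^ 2)) h1.le)]
  have him := integrable_poisson_kernel hμ hr
  have heq : ∀ t : ℝ, 1 / ((t : ℂ) - r * Complex.I) - (t : ℂ) / (1 + (t : ℂ) ^ 2) =
      ((t * (1 - r ^ 2) / ((t ^ 2 + r ^ 2) * (1 + t ^ 2)) : ℝ) : ℂ) +
        ((r / (t ^ 2 + r ^ 2) : ℝ) : ℂ) * Complex.I := by
    intro t
    have h0 : ((t : ℂ) ^ 2 + (r : ℂ) ^ 2) ≠ 0 := by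
      exact_mod_cast (by positivity : t ^ 2 + r ^ 2 ≠ 0)
    have h1 : (1 + (t : ℂ) ^ 2) ≠ 0 := by
      exact_mod_cast (by positivity : 1 + t ^ 2 ≠ 0)
    have h2 : ((t : ℂ) - r * Complex.I) * ((t : ℂ) + r * Complex.I) = (t : ℂ) ^ 2 + (r : ℂ) ^ 2 := by
      linear_combination -(r : ℂ) ^ 2 * Complex.I_sq
    have h3 : (t : ℂ) - r * Complex.I ≠ 0 := left_ne_zero_of_mul (h2 ▸ h0)
    have h4 : 1 / ((t : ℂ) - r * Complex.I) =
        ((t : ℂ) + r * Complex.I) / ((t : ℂ) ^ 2 + (r : ℂ) ^ 2) := by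
      rw [div_eq_div_iff h3 h0, ← h2]
      ring
    rw [h4]
    push_cast
    field_simp
    ring
  simp_rw [heq]
  rw [integral_add hre.ofReal (him.ofReal.mul_const _), integral_mul_const,
    integral_complex_ofReal, integral_complex_ofReal]
  simp

theorem muSym_le_of_poisson (hμ : Integrable (fun t : ℝ => 1 / (1 + t ^ 2)) μ) (hr : 0 < r) :
    muSym μ r ≤ ENNReal.ofReal (2 * r * ∫ t : ℝ, r / (t ^ 2 + r ^ 2) ∂μ) := by
  have him := (integrable_poisson_kernel hμ hr).const_mul (2 * r)
  rw [← integral_const_mul, ofReal_integral_eq_lintegral_ofReal him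
    (Eventually.of_forall fun t => by positivity), muSym,
    ← lintegral_indicator_one measurableSet_Ioo]
  refine lintegral_mono fun t => ?_
  by_cases ht : t ∈ Ioo (-r) r
  · rw [indicator_of_mem ht, Pi.one_apply, ENNReal.one_le_ofReal, ← mul_div_assoc,
      one_le_div (by positivity)]
    nlinarith [abs_lt.2 ht, sq_lt_sq' ht.1 ht.2]
  · simp [indicator_of_notMem ht]

/-- The Poisson kernel is dominated by a geometric combination of indicators of dyadic
intervals. -/
theorem ofReal_kernel_le_tsum (hr : 0 < r) (x : ℝ) :
    ENNReal.ofReal (r ^ 2 / (x ^ 2 + r ^ 2)) ≤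
      ∑' k : ℕ, ENNReal.ofReal (4 * (1 / 4) ^ k) *
        (Ioo (-(2 ^ k * r)) (2 ^ k * r)).indicator 1 x := by
  have hex : ∃ k : ℕ, |x| < 2 ^ k * r := by
    obtain ⟨k, hk⟩ := pow_unbounded_of_one_lt (|x| / r) (one_lt_two)
    exact ⟨k, (div_lt_iff₀ hr).1 hk⟩
  classical
  set k := Nat.find hex with hk
  have hkx : |x| < 2 ^ k * r := Nat.find_spec hex
  refine le_trans ?_ (ENNReal.le_tsum k)
  rw [indicator_of_mem (show x ∈ Ioo _ _ from abs_lt.1 hkx), Pi.one_apply, mul_one]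
  refine ENNReal.ofReal_le_ofReal ?_
  rw [div_le_iff₀ (by positivity)]
  rcases Nat.eq_zero_or_pos k with h0 | hpos
  · rw [h0]
    nlinarith [sq_nonneg x, sq_nonneg r]
  · obtain ⟨j, hj⟩ := Nat.exists_eq_succ_of_ne_zero hpos.ne'
    have hmin : 2 ^ j * r ≤ |x| := not_lt.1 (Nat.find_min hex (by omega : j < k))
    have hsq : (2 ^ j * r) ^ 2 ≤ x ^ 2 := by
      rw [← sq_abs x]
      gcongr
    rw [hj, pow_succ (1 / 4 : ℝ)]
    have e : (1 / 4 : ℝ) ^ j * (2 ^ j * r) ^ 2 = r ^ 2 := by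
      rw [mul_pow, ← pow_mul, mul_comm j 2, pow_mul, ← mul_assoc, ← mul_pow]
      norm_num
    have hp : 0 < (1 / 4 : ℝ) ^ j := by positivity
    nlinarith [mul_le_mul_of_nonneg_left hsq hp.le, mul_nonneg hp.le (sq_nonneg r)]

theorem lintegral_kernel_le_tsum (μ : Measure ℝ) (hr : 0 < r) :
    ∫⁻ x, ENNReal.ofReal (r ^ 2 / (x ^ 2 + r ^ 2)) ∂μ ≤
      ∑' k : ℕ, ENNReal.ofReal (4 * (1 / 4) ^ k) * muSym μ (2 ^ k * r) := by
  refine (lintegral_mono (ofReal_kernel_le_tsum hr)).trans (le_of_eq ?_)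
  rw [lintegral_tsum fun k => by
    exact ((measurable_one.indicator measurableSet_Ioo).const_mul _).aemeasurable]
  refine tsum_congr fun k => ?_
  rw [lintegral_const_mul _ (measurable_one.indicator measurableSet_Ioo),
    lintegral_indicator_one measurableSet_Ioo, muSym]

/-- An Abelian estimate: growth of `μ((-r, r))` controls the Poisson integral. -/
theorem lintegral_kernel_le {g : ℝ → ℝ} {C κ R : ℝ} (hC : 0 ≤ C) (hκ0 : 0 ≤ κ) (hκ : κ < 4)
    (hR : 0 < R) (hg : ∀ s, R ≤ s → 0 ≤ g s) (hdouble : ∀ s, R ≤ s → g (2 * s) ≤ κ * g s)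
    (hμ : ∀ s, R ≤ s → muSym μ s ≤ ENNReal.ofReal (C * g s)) (hr : R ≤ r) :
    ∫⁻ x, ENNReal.ofReal (r ^ 2 / (x ^ 2 + r ^ 2)) ∂μ ≤
      ENNReal.ofReal (4 * C * g r * (1 - κ / 4)⁻¹) := by
  have hr0 : 0 < r := hR.trans_le hr
  have hge : ∀ k : ℕ, R ≤ 2 ^ k * r := fun k =>
    hr.trans (le_mul_of_one_le_left hr0.le (one_le_pow₀ one_le_two))
  have hiter : ∀ k : ℕ, g (2 ^ k * r) ≤ κ ^ k * g r := by
    intro k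
    induction k with
    | zero => simp
    | succ k ih =>
      rw [pow_succ', mul_assoc, pow_succ', mul_assoc]
      exact (hdouble _ (hge k)).trans (mul_le_mul_of_nonneg_left ih hκ0)
  have hgr := hg r hr
  have hsum : HasSum (fun k : ℕ => 4 * C * g r * (κ / 4) ^ k) (4 * C * g r * (1 - κ / 4)⁻¹) :=
    (hasSum_geometric_of_lt_one (by positivity) (by linarith)).mul_left _
  refine (lintegral_kernel_le_tsum μ hr0).trans ?_
  rw [← hsum.tsum_eq, ENNReal.ofReal_tsum_of_nonneg (fun k => by positivity) hsum.summable]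
  refine ENNReal.tsum_le_tsum fun k => ?_
  refine (mul_le_mul_right (hμ _ (hge k)) _).trans ?_
  rw [← ENNReal.ofReal_mul (by positivity)]
  refine ENNReal.ofReal_le_ofReal ?_
  calc 4 * (1 / 4) ^ k * (C * g (2 ^ k * r)) ≤ 4 * (1 / 4) ^ k * (C * (κ ^ k * g r)) := by
        gcongr
        exact hiter k
    _ = 4 * C * g r * (κ / 4) ^ k := by
        rw [div_eq_mul_one_div κ, mul_pow]
        ring

end Poisson

section Scale

variable {a T : ℝ} {P : ℝ → ℝ}

theorem intervalIntegral_pos_of_not_ae_eq_zero {f : ℝ → ℝ} (haT : a ≤ T)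
    (hf : IntervalIntegrable f volume a T) (h0 : ∀ᵐ s ∂volume.restrict (Ioc a T), 0 ≤ f s)
    (hne : ¬ ∀ᵐ s ∂volume.restrict (Ioo a T), f s = 0) : 0 < ∫ s in a..T, f s := by
  refine (intervalIntegral.integral_nonneg_of_ae_restrict haT ?_).lt_of_ne fun h => hne ?_
  · rwa [← restrict_Ioc_eq_restrict_Icc]
  · have := (intervalIntegral.integral_eq_zero_iff_of_le_of_nonneg_ae haT h0 hf).1 h.symm
    exact ae_mono (Measure.restrict_mono_set _ Ioo_subset_Ioc_self) this

theorem tendsto_one_div_sqrt_atTop (haT : a < T) (hP : ContinuousOn P (Icc a T)) (hPa : P a = 0)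
    (hpos : ∀ t ∈ Ioc a T, 0 < P t) :
    Tendsto (fun t => 1 / √(P t)) (𝓝[>] a) atTop := by
  simp only [one_div]
  refine Tendsto.inv_tendsto_nhdsGT_zero (tendsto_nhdsWithin_iff.2 ⟨?_, ?_⟩)
  · have h : Tendsto P (𝓝[>] a) (𝓝 (P a)) :=
      ((hP a (left_mem_Icc.2 haT.le)).mono_of_mem_nhdsWithin (Icc_mem_nhdsGT haT))
    have := (Real.continuous_sqrt.tendsto (P a)).comp h
    rwa [hPa, Real.sqrt_zero] at this
  · filter_upwards [Ioc_mem_nhdsGT haT] with t ht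
    exact Real.sqrt_pos.2 (hpos t ht)

/-- Every large `r` is of the form `1 / √(P t)` with `t` close to `a`. -/
theorem eventually_exists_sq_mul_eq_one (haT : a < T) (hP : ContinuousOn P (Icc a T))
    (hPa : P a = 0) (hpos : ∀ t ∈ Ioc a T, 0 < P t) {p : ℝ → Prop} (hp : ∀ᶠ t in 𝓝[>] a, p t) :
    ∀ᶠ r in atTop, ∃ t ∈ Ioc a T, p t ∧ r ^ 2 * P t = 1 ∧ 1 / √(P t) = r := by
  obtain ⟨u, hu, hup⟩ := (mem_nhdsGT_iff_exists_Ioo_subset' haT).1 hp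
  set v := min u T with hv
  have hav : a < v := lt_min hu haT
  have hvT : v ≤ T := min_le_right _ _
  have hlim : Tendsto (fun r : ℝ => (r ^ 2)⁻¹) atTop (𝓝 0) :=
    (tendsto_pow_atTop two_ne_zero).inv_tendsto_atTop
  filter_upwards [hlim.eventually_lt_const (hpos v ⟨hav, hvT⟩), eventually_gt_atTop 0]
    with r hr hr0
  obtain ⟨t, ht, htr⟩ := intermediate_value_Ioo hav.le (hP.mono (Icc_subset_Icc_right hvT))
    (show (r ^ 2)⁻¹ ∈ Ioo (P a) (P v) from ⟨by rw [hPa]; positivity, hr⟩)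
  refine ⟨t, ⟨ht.1, ht.2.le.trans hvT⟩, hup ⟨ht.1, ht.2.trans_le (min_le_left _ _)⟩, ?_, ?_⟩
  · rw [htr]
    field_simp
  · rw [htr, Real.sqrt_inv, Real.sqrt_sq hr0.le, one_div, inv_inv]

theorem one_div_sqrt_sq_mul {x : ℝ} (hx : 0 < x) : (1 / √x) ^ 2 * x = 1 := by
  rw [div_pow, Real.sq_sqrt hx.le]
  field_simp

end Scale

section SpectralMeasure

variable {a : ℝ} {b : EReal} {H : ℝ → Matrix (Fin 2) (Fin 2) ℝ} {T t r : ℝ} {μ : Measure ℝ}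

theorem IsHamiltonian.continuousOn_m1 (hH : IsHamiltonian a b H) (haT : a ≤ T)
    (hTb : (T : EReal) < b) : ContinuousOn (m1 a H) (Icc a T) := by
  have h := hH.locInt 0 0 T haT hTb
  have := intervalIntegral.continuousOn_primitive_interval' h left_mem_uIcc
  rwa [uIcc_of_le haT] at this

theorem IsHamiltonian.continuousOn_m2 (hH : IsHamiltonian a b H) (haT : a ≤ T)
    (hTb : (T : EReal) < b) : ContinuousOn (m2 a H) (Icc a T) := by
  have h := hH.locInt 1 1 T haT hTb
  have := intervalIntegral.continuousOn_primitive_interval' h left_mem_uIcc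
  rwa [uIcc_of_le haT] at this

theorem IsHamiltonian.m1_pos (hH : IsHamiltonian a b H) (hdiag : DiagNonVanishing a b H)
    (hat : a < t) (htb : (t : EReal) < b) : 0 < m1 a H t :=
  intervalIntegral_pos_of_not_ae_eq_zero hat.le (hH.locInt 0 0 t hat.le htb)
    ((hH.ae_Ioc htb).mono fun _ hs => hs.diag_nonneg) (hdiag.1 t hat htb)

theorem IsHamiltonian.m2_pos (hH : IsHamiltonian a b H) (hdiag : DiagNonVanishing a b H)
    (hat : a < t) (htb : (t : EReal) < b) : 0 < m2 a H t :=
  intervalIntegral_pos_of_not_ae_eq_zero hat.le (hH.locInt 1 1 t hat.le htb)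
    ((hH.ae_Ioc htb).mono fun _ hs => hs.diag_nonneg) (hdiag.2 t hat htb)

theorem IsSpectralMeasure.integrable (hμ : IsSpectralMeasure a b H μ) :
    Integrable (fun t : ℝ => 1 / (1 + t ^ 2)) μ := by
  obtain ⟨-, -, hfin, -⟩ := hμ
  exact integrable_one_div_one_add_sq hfin

theorem IsSpectralMeasure.exists_linear_bounds (hH : IsHamiltonian a b H)
    (hμ : IsSpectralMeasure a b H μ) :
    ∃ β : ℝ, 0 ≤ β ∧ ∀ r t : ℝ, 0 < r → a ≤ t → (t : EReal) < b →
      r ^ 2 * (m1 a H t * m2 a H t) = 1 →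
      (Mmat a H t).det / m2 a H t ≤ 9 * ((β * r + ∫ x : ℝ, r / (x ^ 2 + r ^ 2) ∂μ) / r) ∧
        β * r + ∫ x : ℝ, r / (x ^ 2 + r ^ 2) ∂μ ≤ 19 * (r * m1 a H t) := by
  have hint := hμ.integrable
  obtain ⟨q, ⟨W, hW, hlim⟩, -, α, β, hβ, hq⟩ := hμ
  refine ⟨β, hβ, fun r t hr hat htb hrt => ?_⟩
  have him : ((r : ℂ) * Complex.I).im ≠ 0 := by simpa using hr.ne'
  have hl := hlim _ him 0 (by simp)
  simp only [mul_zero, zero_add] at hl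
  have hb := hW.weyl_bounds hH hr hl hat htb hrt
  have hqi : (q (r * Complex.I)).im = β * r + ∫ x : ℝ, r / (x ^ 2 + r ^ 2) ∂μ := by
    rw [hq _ him, Complex.add_im, im_integral_herglotz_kernel hint hr]
    simp
  rwa [hqi] at hb

theorem IsSpectralMeasure.bounds (hH : IsHamiltonian a b H) (hdiag : DiagNonVanishing a b H)
    (hμ : IsSpectralMeasure a b H μ) (hr : 0 < r) (hat : a ≤ t) (htb : (t : EReal) < b)
    (hrt : r ^ 2 * (m1 a H t * m2 a H t) = 1) :
    (Mmat a H t).det / m2 a H t ≤ 9 * ((∫ x : ℝ, r / (x ^ 2 + r ^ 2) ∂μ) / r) ∧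
      ∫ x : ℝ, r / (x ^ 2 + r ^ 2) ∂μ ≤ 19 * (r * m1 a H t) := by
  obtain ⟨β, hβ, h⟩ := hμ.exists_linear_bounds hH
  suffices β = 0 by simpa [this] using h r t hr hat htb hrt
  by_contra hne
  have hβ' : 0 < β := hβ.lt_of_ne' hne
  have hat' : a < t := hat.lt_of_ne fun e => by
    subst e
    simp [m1] at hrt
  have hc : Tendsto (m1 a H) (𝓝[>] a) (𝓝 (m1 a H a)) :=
    (hH.continuousOn_m1 hat htb a (left_mem_Icc.2 hat)).mono_of_mem_nhdsWithin
      (Icc_mem_nhdsGT hat')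
  have h0 : m1 a H a < β / 19 := by
    simp only [m1, intervalIntegral.integral_same]
    positivity
  obtain ⟨s, hs, hst⟩ := ((hc.eventually_lt_const h0).and (Ioc_mem_nhdsGT hat')).exists
  have hsb : (s : EReal) < b := (EReal.coe_le_coe_iff.2 hst.2).trans_lt htb
  have hP := mul_pos (hH.m1_pos hdiag hst.1 hsb) (hH.m2_pos hdiag hst.1 hsb)
  have hρ : 0 < 1 / √(m1 a H s * m2 a H s) := by positivity
  have h2 := (h _ s hρ hst.1.le hsb (one_div_sqrt_sq_mul hP)).2
  have h3 : 0 ≤ ∫ x : ℝ, (1 / √(m1 a H s * m2 a H s)) /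
      (x ^ 2 + (1 / √(m1 a H s * m2 a H s)) ^ 2) ∂μ :=
    integral_nonneg fun x => by positivity
  nlinarith

end SpectralMeasure

section Growth

variable {a : ℝ} {b : EReal} {H : ℝ → Matrix (Fin 2) (Fin 2) ℝ} {T : ℝ} {μ : Measure ℝ}
  {g : ℝ → ℝ} {α C : ℝ}

/-- For `g` of index less than `2`, an `O(g)` bound for `μ((-r, r))` is inherited by the Poisson
integral, with a constant factor depending only on `g`. -/
theorem RegularlyVarying.exists_poisson_bound (hg : RegularlyVarying g α) (hα : α < 2)
    (hμ : Integrable (fun t : ℝ => 1 / (1 + t ^ 2)) μ) :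
    ∃ K : ℝ, 0 < K ∧ ∀ C : ℝ, 0 ≤ C →
      (∀ᶠ r in atTop, muSym μ r ≤ ENNReal.ofReal (C * g r)) →
      ∀ᶠ r in atTop, r * ∫ x : ℝ, r / (x ^ 2 + r ^ 2) ∂μ ≤ C * K * g r := by
  have h24 : (2 : ℝ) ^ α < 4 := by
    have := Real.rpow_lt_rpow_of_exponent_lt one_lt_two hα
    norm_num at this
    exact this
  obtain ⟨κ, h2κ, hκ⟩ := exists_between h24
  have hκ0 : 0 < κ := (by positivity : (0 : ℝ) < 2 ^ α).trans h2κ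
  refine ⟨4 * (1 - κ / 4)⁻¹, mul_pos four_pos (inv_pos.2 (by linarith)), fun C hC hbound => ?_⟩
  have hdouble : ∀ᶠ r in atTop, g (2 * r) / g r < κ :=
    (hg.2.2 2 two_pos).eventually_lt_const h2κ
  obtain ⟨R, hR⟩ := eventually_atTop.1 ((hdouble.and hbound).and (eventually_gt_atTop 0))
  filter_upwards [eventually_ge_atTop R] with r hr
  have hR0 : 0 < R := (hR R le_rfl).2
  have hr0 : 0 < r := hR0.trans_le hr
  have hgp : ∀ s, R ≤ s → 0 < g s := fun s hs => hg.2.1 s (hR0.trans_le hs)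
  have hl := lintegral_kernel_le hC hκ0.le hκ hR0 (fun s hs => (hgp s hs).le)
    (fun s hs => ((div_lt_iff₀ (hgp s hs)).1 (hR s hs).1.1).le) (fun s hs => (hR s hs).1.2) hr
  have hgr := hgp r hr
  have hinv : 0 < (1 - κ / 4)⁻¹ := inv_pos.2 (by linarith)
  have hi := (integrable_poisson_kernel hμ hr0).const_mul r
  rw [← integral_const_mul]
  refine (ENNReal.ofReal_le_ofReal_iff (by positivity)).1 ?_
  rw [ofReal_integral_eq_lintegral_ofReal hi (Eventually.of_forall fun x => by positivity)]
  convert hl using 2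
  · ext x
    rw [pow_two r, mul_div_assoc]
  · ring

theorem IsSpectralMeasure.muSym_le (hH : IsHamiltonian a b H) (hdiag : DiagNonVanishing a b H)
    (hg : RegularlyVarying g α) (hμ : IsSpectralMeasure a b H μ)
    (h : ∀ᶠ t in 𝓝[>] a, m1 a H t / (m1 a H t * m2 a H t *
      g (1 / √(m1 a H t * m2 a H t))) ≤ C) :
    ∀ᶠ r in atTop, muSym μ r ≤ ENNReal.ofReal (38 * C * g r) := by
  obtain ⟨T, haT, hTb⟩ := EReal.lt_iff_exists_real_btwn.1 hH.a_lt_b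
  replace haT : a < T := EReal.coe_lt_coe_iff.1 haT
  have hlt : ∀ t ∈ Ioc a T, (t : EReal) < b := fun t ht =>
    (EReal.coe_le_coe_iff.2 ht.2).trans_lt hTb
  have hpos : ∀ t ∈ Ioc a T, 0 < m1 a H t * m2 a H t := fun t ht =>
    mul_pos (hH.m1_pos hdiag ht.1 (hlt t ht)) (hH.m2_pos hdiag ht.1 (hlt t ht))
  filter_upwards [eventually_exists_sq_mul_eq_one haT
    ((hH.continuousOn_m1 haT.le hTb).mul (hH.continuousOn_m2 haT.le hTb)) (by simp [m1]) hpos h,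
    eventually_gt_atTop 0] with r ⟨t, ht, htC, hrt, hr⟩ hr0
  have hgr := hg.2.1 r hr0
  have hP := hpos t ht
  refine (muSym_le_of_poisson hμ.integrable hr0).trans (ENNReal.ofReal_le_ofReal ?_)
  have hb := (hμ.bounds hH hdiag hr0 ht.1.le (hlt t ht) hrt).2
  simp only [Pi.mul_apply] at hr hrt
  rw [hr, div_le_iff₀ (mul_pos hP hgr)] at htC
  calc 2 * r * ∫ x : ℝ, r / (x ^ 2 + r ^ 2) ∂μ ≤ 2 * r * (19 * (r * m1 a H t)) := by gcongr
    _ = 38 * r ^ 2 * m1 a H t := by ring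
    _ ≤ 38 * r ^ 2 * (C * (m1 a H t * m2 a H t * g r)) := by gcongr
    _ = 38 * C * g r * (r ^ 2 * (m1 a H t * m2 a H t)) := by ring
    _ = 38 * C * g r := by rw [hrt, mul_one]

theorem IsSpectralMeasure.eventually_det_ratio (hH : IsHamiltonian a b H)
    (hdiag : DiagNonVanishing a b H) (hg : RegularlyVarying g α)
    (hμ : IsSpectralMeasure a b H μ)
    (h : ∀ᶠ r in atTop, r * ∫ x : ℝ, r / (x ^ 2 + r ^ 2) ∂μ ≤ C * g r) :
    ∀ᶠ t in 𝓝[>] a,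
      0 ≤ (Mmat a H t).det / m2 a H t / (m1 a H t * m2 a H t *
        g (1 / √(m1 a H t * m2 a H t))) ∧
      (Mmat a H t).det / m2 a H t / (m1 a H t * m2 a H t *
        g (1 / √(m1 a H t * m2 a H t))) ≤ 9 * C := by
  obtain ⟨T, haT, hTb⟩ := EReal.lt_iff_exists_real_btwn.1 hH.a_lt_b
  replace haT : a < T := EReal.coe_lt_coe_iff.1 haT
  have hlt : ∀ t ∈ Ioc a T, (t : EReal) < b := fun t ht =>
    (EReal.coe_le_coe_iff.2 ht.2).trans_lt hTb
  have hpos : ∀ t ∈ Ioc a T, 0 < m1 a H t * m2 a H t := fun t ht =>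
    mul_pos (hH.m1_pos hdiag ht.1 (hlt t ht)) (hH.m2_pos hdiag ht.1 (hlt t ht))
  have hlim := tendsto_one_div_sqrt_atTop haT
    ((hH.continuousOn_m1 haT.le hTb).mul (hH.continuousOn_m2 haT.le hTb)) (by simp [m1]) hpos
  filter_upwards [hlim.eventually h, Ioc_mem_nhdsGT haT] with t hCt ht
  simp only [Pi.mul_apply] at hCt
  have hP := hpos t ht
  have hrt := one_div_sqrt_sq_mul hP
  have hr0 : 0 < 1 / √(m1 a H t * m2 a H t) := by positivity
  set r := 1 / √(m1 a H t * m2 a H t) with hr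
  have hgr := hg.2.1 r hr0
  have hm2 := hH.m2_pos hdiag ht.1 (hlt t ht)
  have hb := (hμ.bounds hH hdiag hr0 ht.1.le (hlt t ht) hrt).1
  refine ⟨div_nonneg (div_nonneg (hH.det_nonneg ht.1.le (hlt t ht)) hm2.le)
    (mul_pos hP hgr).le, ?_⟩
  rw [div_le_iff₀ (mul_pos hP hgr)]
  refine hb.trans ?_
  have e : ∀ I : ℝ, I / r = r * I * (m1 a H t * m2 a H t) := fun I => by
    rw [div_eq_iff hr0.ne']
    linear_combination -I * hrt
  rw [e]
  nlinarith [mul_le_mul_of_nonneg_right hCt hP.le]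

end Growth

/-- Theorem 4.12: limsup conditions for the spectral measure. -/
theorem stmt14 (a : ℝ) (b : EReal) (H : ℝ → Matrix (Fin 2) (Fin 2) ℝ)
    (hH : IsHamiltonian a b H) (hdiag : DiagNonVanishing a b H)
    (g : ℝ → ℝ) (α : ℝ) (hα : α ≤ 2) (hg : RegularlyVarying g α)
    (hginf : Tendsto g atTop atTop)
    (μ : Measure ℝ) (hμ : IsSpectralMeasure a b H μ) :
    ((∃ C : ℝ, ∀ᶠ t in nhdsWithin a (Set.Ioi a),
        m1 a H t / (m1 a H t * m2 a H t *
          g (1 / Real.sqrt (m1 a H t * m2 a H t))) ≤ C) →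
      memFg g μ) ∧
    (Tendsto (fun t : ℝ => m1 a H t / (m1 a H t * m2 a H t *
          g (1 / Real.sqrt (m1 a H t * m2 a H t))))
        (nhdsWithin a (Set.Ioi a)) (nhds 0) →
      memFg0 g μ) ∧
    (α < 2 →
      (memFg g μ →
        ∃ C : ℝ, ∀ᶠ t in nhdsWithin a (Set.Ioi a),
          (Mmat a H t).det / m2 a H t / (m1 a H t * m2 a H t *
            g (1 / Real.sqrt (m1 a H t * m2 a H t))) ≤ C) ∧
      (memFg0 g μ →
        Tendsto (fun t : ℝ => (Mmat a H t).det / m2 a H t / (m1 a H t * m2 a H t *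
            g (1 / Real.sqrt (m1 a H t * m2 a H t))))
          (nhdsWithin a (Set.Ioi a)) (nhds 0))) := by
  refine ⟨?_, ?_, fun hα2 => ?_⟩
  · rintro ⟨C, hC⟩
    exact ⟨38 * C, hμ.muSym_le hH hdiag hg hC⟩
  · intro h ε hε
    have := hμ.muSym_le hH hdiag hg (h.eventually_le_const (show (0 : ℝ) < ε / 38 by positivity))
    rwa [mul_div_cancel₀ ε (by norm_num : (38 : ℝ) ≠ 0)] at this
  · obtain ⟨K, hK, hbound⟩ := hg.exists_poisson_bound hα2 hμ.integrable
    constructor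
    · rintro ⟨C, hC⟩
      refine ⟨9 * (|C| * K), ?_⟩
      have hC' : ∀ᶠ r in atTop, muSym μ r ≤ ENNReal.ofReal (|C| * g r) := by
        filter_upwards [hC, eventually_gt_atTop 0] with r hr hr0
        refine hr.trans (ENNReal.ofReal_le_ofReal ?_)
        exact mul_le_mul_of_nonneg_right (le_abs_self C) (hg.2.1 r hr0).le
      exact (hμ.eventually_det_ratio hH hdiag hg (hbound _ (abs_nonneg C) hC')).mono
        fun _ ht => ht.2
    · intro h
      refine tendsto_order.2 ⟨fun c hc => ?_, fun c hc => ?_⟩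
      · have hε := hμ.eventually_det_ratio hH hdiag hg (hbound 1 zero_le_one (h 1 one_pos))
        exact hε.mono fun _ ht => hc.trans_le ht.1
      · have hpos : 0 < c / (18 * K) := by positivity
        have hε := hμ.eventually_det_ratio hH hdiag hg (hbound _ hpos.le (h _ hpos))
        refine hε.mono fun _ ht => ht.2.trans_lt ?_
        have : 9 * (c / (18 * K) * K) = c / 2 := by field_simp; norm_num
        rw [this]
        exact half_lt_self hc

end
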